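/- arXiv:2004.05995 — 5 statements merged into one kernel-verified Lean document; each statement's English description precedes it below -/
import Mathlib

section
/- For every real number M ≥ 1 there exists a constant C = C(M) ∈ [0,∞), depending only on M, with the following property: for every real Banach lattice E and every bounded linear operator Q on E such that the operator exponential e^{tQ} is a positive operator for every t ∈ [0,∞) and such that sup_{t ∈ [-1,∞)} ‖e^{tQ}‖ ≤ M, one has ‖Q‖ ≤ C. -/
open Filter Topology

section SolidNorm

variable {E : Type*} [NormedAddCommGroup E] [Lattice E] [HasSolidNorm E] [IsOrderedAddMonoid E]

theorem norm_le_norm_of_nonneg_of_le {a b : E} (ha : 0 ≤ a) (hab : a ≤ b) : ‖a‖ ≤ ‖b‖ :=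
  norm_le_norm_of_abs_le_abs (by rwa [abs_of_nonneg ha, abs_of_nonneg (ha.trans hab)])

theorem norm_posPart_le_norm (a : E) : ‖a⁺‖ ≤ ‖a‖ :=
  norm_le_norm_of_abs_le_abs (by
    rw [abs_of_nonneg (posPart_nonneg a)]
    exact sup_le (le_abs_self a) (abs_nonneg a))

/-- An operator dominated in modulus by `P` on the positive cone has norm at most `‖P‖`. -/
theorem opNorm_le_of_dominated [NormedSpace ℝ E] {S P : E →L[ℝ] E} (h₁ : ∀ x, 0 ≤ x → S x ≤ P x)
    (h₂ : ∀ x, 0 ≤ x → -S x ≤ P x) : ‖S‖ ≤ ‖P‖ := by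
  refine S.opNorm_le_bound (norm_nonneg _) fun x => ?_
  have hp := posPart_nonneg x
  have hn := negPart_nonneg x
  have e : S x = S x⁺ - S x⁻ := by rw [← map_sub, posPart_sub_negPart]
  have e' : P |x| = P x⁺ + P x⁻ := by rw [← map_add, posPart_add_negPart]
  have h : |S x| ≤ P |x| := by
    rw [e, e']
    refine sup_le ?_ ?_
    · rw [sub_eq_add_neg]; exact add_le_add (h₁ _ hp) (h₂ _ hn)
    · rw [neg_sub, sub_eq_neg_add]; exact add_le_add (h₂ _ hp) (h₁ _ hn)
  calc ‖S x‖ ≤ ‖P |x|‖ := norm_le_norm_of_abs_le_abs (h.trans (le_abs_self _))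
    _ ≤ ‖P‖ * ‖|x|‖ := P.le_opNorm _
    _ = ‖P‖ * ‖x‖ := by rw [norm_abs_eq_norm]

end SolidNorm

section VectorLattice

variable {E : Type*} [AddCommGroup E] [Lattice E] [IsOrderedAddMonoid E] [Module ℝ E]
  [PosSMulStrictMono ℝ E]

/-- Scalar multiples of the positive and negative parts of a vector are disjoint. -/
theorem smul_posPart_inf_smul_negPart_nonpos (v : E) (a b : ℝ) :
    a • v⁺ ⊓ b • v⁻ ≤ 0 := by
  set c : ℝ := max 1 (max a b) with hc
  have hc0 : 0 < c := lt_of_lt_of_le one_pos (le_max_left _ _)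
  have ha : a ≤ c := (le_max_left _ _).trans (le_max_right _ _)
  have hb : b ≤ c := (le_max_right _ _).trans (le_max_right _ _)
  have h1 : a • v⁺ ⊓ b • v⁻ ≤ c • v⁺ ⊓ c • v⁻ :=
    inf_le_inf (smul_le_smul_of_nonneg_right ha (posPart_nonneg v))
      (smul_le_smul_of_nonneg_right hb (negPart_nonneg v))
  have h2 : c⁻¹ • (c • v⁺ ⊓ c • v⁻) ≤ 0 := by
    rw [← posPart_inf_negPart_eq_zero v]
    refine le_inf ?_ ?_
    · simpa [smul_smul, hc0.ne'] using
        smul_le_smul_of_nonneg_left (inf_le_left : c • v⁺ ⊓ c • v⁻ ≤ _) (inv_pos.2 hc0).le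
    · simpa [smul_smul, hc0.ne'] using
        smul_le_smul_of_nonneg_left (inf_le_right : c • v⁺ ⊓ c • v⁻ ≤ _) (inv_pos.2 hc0).le
  have h3 := smul_le_smul_of_nonneg_left h2 hc0.le
  rw [smul_smul, mul_inv_cancel₀ hc0.ne', one_smul, smul_zero] at h3
  exact h1.trans h3

/-- Comparison of two successive cutoffs of a positive vector `x`. -/
theorem smul_cutoff_le_posPart {x v : E} (hx : 0 ≤ x) {k l m d : ℝ} (hk : 0 ≤ k) (hkl : k ≤ l)
    (hm : 0 ≤ m) (hmd : m * d = 1) :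
    k • (x ⊓ m • v⁺) ≤ (x ⊓ m • (v + d • x)⁺ - x + (v + l • x))⁺ := by
  set p := k • (x ⊓ m • v⁺) with hp
  set Z := x ⊓ m • (v + d • x)⁺ - x + (v + l • x) with hZ
  have hp0 : p ≤ l • x := (smul_le_smul_of_nonneg_left inf_le_left hk).trans
    (smul_le_smul_of_nonneg_right hkl hx)
  have hp1 : p ≤ (k * m) • v⁺ := by
    rw [mul_smul]; exact smul_le_smul_of_nonneg_left inf_le_right hk
  have h1 : x - m • v⁻ ≤ x ⊓ m • (v + d • x)⁺ := by
    refine le_inf (sub_le_self _ (smul_nonneg hm (negPart_nonneg v))) ?_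
    have h2 : m • (v + d • x) ≤ m • (v + d • x)⁺ :=
      smul_le_smul_of_nonneg_left (le_posPart _) hm
    have h3 : -(m • v⁻) ≤ m • v := by
      rw [← smul_neg]
      exact smul_le_smul_of_nonneg_left (neg_le.1 (neg_le_negPart v)) hm
    rw [smul_add, smul_smul, hmd, one_smul] at h2
    refine le_trans ?_ h2
    rw [sub_eq_neg_add]
    gcongr
  have h4 : p - (m + 1) • v⁻ ≤ Z := by
    have h5 : -v⁻ ≤ v := neg_le.1 (neg_le_negPart v)
    calc p - (m + 1) • v⁻ = (x - m • v⁻) - x + (-v⁻ + p) := by module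
      _ ≤ Z := by rw [hZ]; gcongr
  have h6 : p - Z⁺ ≤ 0 := by
    refine le_trans (le_inf ?_ ?_)
      (smul_posPart_inf_smul_negPart_nonpos v (k * m) (m + 1))
    · exact (sub_le_self _ (posPart_nonneg Z)).trans hp1
    · rw [sub_le_comm]; exact h4.trans (le_posPart Z)
  exact sub_nonpos.1 h6

end VectorLattice

section BanachLattice

variable {E : Type*} [NormedAddCommGroup E] [Lattice E] [HasSolidNorm E] [IsOrderedAddMonoid E]
  [NormedSpace ℝ E] [PosSMulStrictMono ℝ E]

/-- A positive operator within distance `δ` of the identity dominates `(1 - k) • 1` for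
every `k > δ`. -/
theorem le_apply_of_norm_sub_one_le {T : E →L[ℝ] E} (hT : ∀ x, 0 ≤ x → 0 ≤ T x) {δ k : ℝ}
    (hδ : ‖T - 1‖ ≤ δ) (hk : δ < k) {x : E} (hx : 0 ≤ x) : (1 - k) • x ≤ T x := by
  have hδ0 : 0 ≤ δ := (norm_nonneg _).trans hδ
  set c : ℝ := (δ + k) / 2 with hc
  have hδc : δ < c := by linarith
  have hck : c < k := by linarith
  have hc0 : 0 < c := hδ0.trans_lt hδc
  set y := x - T x with hy
  set u := (y - k • x)⁺ with hu
  have hux : u ≤ x := by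
    refine sup_le ?_ hx
    rw [hy, sub_sub]
    exact sub_le_self _ (add_nonneg (hT x hx) (smul_nonneg (hc0.trans hck).le hx))
  have key : ∀ N : ℕ, k - c ≤ N → ‖u‖ ≤ (δ / c) ^ N * ‖x‖ := by
    intro N hN
    set m : ℝ := N / (k - c) with hm
    have hm1 : 1 ≤ m := (one_le_div (by linarith)).2 hN
    have hm0 : 0 < m := by linarith
    have hmN : c + N * m⁻¹ = k := by
      have : (N : ℝ) ≠ 0 := by linarith
      rw [hm]; field_simp; ring
    let X : ℕ → E := fun j => x ⊓ m • (y - (c + j * m⁻¹) • x)⁺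
    have hX0 : ∀ j, 0 ≤ X j := fun j => le_inf hx (smul_nonneg hm0.le (posPart_nonneg _))
    have step : ∀ j, ‖X (j + 1)‖ ≤ δ / c * ‖X j‖ := by
      intro j
      have h1 := smul_cutoff_le_posPart (v := y - (c + (j + 1 : ℕ) * m⁻¹) • x) hx hc0.le
        (l := c + (j + 1 : ℕ) * m⁻¹) (le_add_of_nonneg_right (by positivity)) hm0.le
        (mul_inv_cancel₀ hm0.ne')
      have e1 : y - (c + (j + 1 : ℕ) * m⁻¹) • x + m⁻¹ • x = y - (c + j * m⁻¹) • x := by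
        push_cast; module
      rw [e1, sub_add_cancel] at h1
      have h2 : X j - x + y ≤ X j - T (X j) := by
        have h3 : 0 ≤ T (x - X j) := hT _ (sub_nonneg.2 inf_le_left)
        rw [map_sub, sub_nonneg] at h3
        rw [hy, sub_add_sub_cancel]
        gcongr
      have h4 : c • X (j + 1) ≤ (X j - T (X j))⁺ := h1.trans (posPart_mono h2)
      have h5 := norm_le_norm_of_nonneg_of_le (smul_nonneg hc0.le (hX0 _)) h4
      have h6 : ‖X j - T (X j)‖ ≤ δ * ‖X j‖ := by
        rw [norm_sub_rev]
        exact (T - 1).le_of_opNorm_le hδ (X j)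
      rw [norm_smul, Real.norm_of_nonneg hc0.le] at h5
      rw [div_mul_eq_mul_div, le_div_iff₀' hc0]
      exact h5.trans ((norm_posPart_le_norm _).trans h6)
    have hpow : ∀ j, ‖X j‖ ≤ (δ / c) ^ j * ‖x‖ := by
      intro j
      induction j with
      | zero => simpa using norm_le_norm_of_nonneg_of_le (hX0 0) inf_le_left
      | succ j ih =>
        calc ‖X (j + 1)‖ ≤ δ / c * ‖X j‖ := step j
          _ ≤ δ / c * ((δ / c) ^ j * ‖x‖) := by gcongr
          _ = (δ / c) ^ (j + 1) * ‖x‖ := by ring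
    refine le_trans (norm_le_norm_of_nonneg_of_le (posPart_nonneg _) ?_) (hpow N)
    refine le_inf hux ?_
    rw [hmN]
    exact le_smul_of_one_le_left (posPart_nonneg _) hm1
  have hlim : Tendsto (fun N : ℕ => (δ / c) ^ N * ‖x‖) atTop (𝓝 0) := by
    simpa using (tendsto_pow_atTop_nhds_zero_of_lt_one (div_nonneg hδ0 hc0.le)
      ((div_lt_one hc0).2 hδc)).mul_const ‖x‖
  have hu0 : ‖u‖ ≤ 0 := ge_of_tendsto hlim (by
    filter_upwards [eventually_ge_atTop ⌈k - c⌉₊] with N hN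
    exact key N (Nat.ceil_le.1 hN))
  have h7 : y - k • x ≤ 0 := posPart_eq_zero.1 (norm_le_zero_iff.1 hu0)
  rw [hy] at h7
  rw [← sub_nonneg]
  calc (0 : E) ≤ -(x - T x - k • x) := neg_nonneg.2 h7
    _ = _ := by module

/-- The generator of a positive semigroup dominates `-b` for every `b > ‖Q‖`. -/
theorem add_smul_nonneg_of_exp_nonneg [CompleteSpace E] {Q : E →L[ℝ] E}
    (hQ : ∀ t : ℝ, 0 ≤ t → ∀ x : E, 0 ≤ x → 0 ≤ NormedSpace.exp (t • Q) x)
    {b : ℝ} (hb : ‖Q‖ < b) {x : E} (hx : 0 ≤ x) : 0 ≤ Q x + b • x := by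
  have hd : HasDerivAt (fun t : ℝ => NormedSpace.exp (t • Q)) Q 0 := by
    simpa using hasDerivAt_exp_smul_const (𝕂 := ℝ) Q (0 : ℝ)
  have hs := hd.tendsto_slope_zero_right
  simp only [zero_add, zero_smul, NormedSpace.exp_zero] at hs
  have hx' := (((ContinuousLinearMap.apply ℝ E x).continuous.tendsto Q).comp hs).add_const (b • x)
  refine ge_of_tendsto hx' ?_
  filter_upwards [hs.norm.eventually_lt_const hb, self_mem_nhdsWithin] with t ht ht0
  have ht0 : 0 < t := ht0
  rw [norm_smul, norm_inv, Real.norm_of_nonneg ht0.le, inv_mul_lt_iff₀ ht0] at ht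
  have h := le_apply_of_norm_sub_one_le (hQ t ht0.le) le_rfl ht hx
  have h2 := smul_nonneg (inv_pos.2 ht0).le (sub_nonneg.2 h)
  refine h2.trans_eq ?_
  simp only [Function.comp_apply, ContinuousLinearMap.apply_apply, _root_.smul_apply,
    _root_.sub_apply, one_apply_eq_self]
  match_scalars
  · field_simp
  · field_simp
    ring

end BanachLattice

/-- Poisson weights of mean `a ^ 2` times the distance to the mean are controlled by the Poisson
weights of means `a ^ 2 + a` and `a ^ 2 - a`. -/
theorem exp_mul_abs_sub_le {a : ℝ} (ha : 2 ≤ a) (n : ℕ) :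
    Real.exp (-a ^ 2) * |n - a ^ 2| ≤
      8 * a * (Real.exp (-((1 + a⁻¹) * a ^ 2)) * (1 + a⁻¹) ^ n +
        Real.exp (-((1 - a⁻¹) * a ^ 2)) * (1 - a⁻¹) ^ n) := by
  have ha0 : 0 < a := by linarith
  have hu : 0 < a⁻¹ := inv_pos.2 ha0
  have hu1 : 0 < 1 - a⁻¹ := sub_pos.2 (inv_lt_one_of_one_lt₀ (by linarith))
  have e1 : (1 + a⁻¹) * a ^ 2 = a ^ 2 + a := by field_simp
  have e2 : (1 - a⁻¹) * a ^ 2 = a ^ 2 - a := by field_simp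
  suffices h : |n - a ^ 2| ≤
      8 * a * (Real.exp (-a) * (1 + a⁻¹) ^ n + Real.exp a * (1 - a⁻¹) ^ n) by
    rw [e1, e2, neg_add, neg_sub', Real.exp_add, sub_neg_eq_add, Real.exp_add]
    calc _ ≤ _ := mul_le_mul_of_nonneg_left h (Real.exp_pos _).le
      _ = _ := by ring
  have hn : (0 : ℝ) ≤ n := n.cast_nonneg
  have p1 : (1 + a⁻¹) ^ n = Real.exp (n * Real.log (1 + a⁻¹)) := by
    rw [Real.exp_nat_mul, Real.exp_log (by linarith)]
  have p2 : (1 - a⁻¹) ^ n = Real.exp (n * Real.log (1 - a⁻¹)) := by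
    rw [Real.exp_nat_mul, Real.exp_log hu1]
  rcases le_total (a ^ 2) n with h | h
  · rw [abs_of_nonneg (sub_nonneg.2 h)]
    have l : 2 / (1 + 2 * a) ≤ Real.log (1 + a⁻¹) := by
      refine le_trans (le_of_eq ?_) (Real.le_log_one_add_of_nonneg hu.le)
      field_simp
    have b1 : (n - a ^ 2) / (8 * a) ≤ Real.exp (-a) * (1 + a⁻¹) ^ n := by
      rw [p1, ← Real.exp_add]
      calc (n - a ^ 2) / (8 * a) ≤ (2 * (n - a ^ 2) - a) / (1 + 2 * a) + 1 := by
            rw [div_add_one (by positivity), div_le_div_iff₀ (by positivity) (by positivity)]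
            nlinarith [mul_nonneg (sub_nonneg.2 h) ha0.le]
        _ = -a + n * (2 / (1 + 2 * a)) + 1 := by field_simp; ring
        _ ≤ -a + n * Real.log (1 + a⁻¹) + 1 := by gcongr
        _ ≤ _ := Real.add_one_le_exp _
    have b2 : 0 ≤ Real.exp a * (1 - a⁻¹) ^ n := by positivity
    rw [div_le_iff₀' (by positivity)] at b1
    nlinarith
  · rw [abs_of_nonpos (sub_nonpos.2 h), neg_sub]
    have l : -(1 / (a - 1)) ≤ Real.log (1 - a⁻¹) := by
      refine le_trans (le_of_eq ?_) (Real.one_sub_inv_le_log_of_pos hu1)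
      have : a - 1 ≠ 0 := by linarith
      field_simp; ring
    have b1 : (a ^ 2 - n) / (8 * a) ≤ Real.exp a * (1 - a⁻¹) ^ n := by
      rw [p2, ← Real.exp_add]
      have ha1 : 0 < a - 1 := by linarith
      have h8 : Real.exp 2 ≤ 8 := by
        have := Real.exp_one_lt_d9
        have e : Real.exp 2 = Real.exp 1 * Real.exp 1 := by rw [← Real.exp_add]; norm_num
        rw [e]
        nlinarith [Real.exp_pos 1]
      have hz : (a ^ 2 - n) / a ≤ Real.exp (a + n * Real.log (1 - a⁻¹) + 2) := by
        calc (a ^ 2 - n) / a ≤ (a ^ 2 - n - a) / (a - 1) + 2 + 1 := by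
              have : (a ^ 2 - n - a) / (a - 1) + 2 + 1 = (a ^ 2 - n + 2 * a - 3) / (a - 1) := by
                field_simp; ring
              rw [this, div_le_div_iff₀ ha0 ha1]
              nlinarith
          _ = a + n * (-(1 / (a - 1))) + 2 + 1 := by field_simp; ring
          _ ≤ a + n * Real.log (1 - a⁻¹) + 2 + 1 := by gcongr
          _ ≤ _ := Real.add_one_le_exp _
      rw [Real.exp_add] at hz
      have hpos := Real.exp_pos (a + n * Real.log (1 - a⁻¹))
      rw [div_le_iff₀' (by positivity)]
      rw [div_le_iff₀' ha0] at hz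
      refine hz.trans ?_
      rw [mul_comm 8 a, mul_assoc, mul_comm 8]
      gcongr
    have b2 : 0 ≤ Real.exp (-a) * (1 + a⁻¹) ^ n := by positivity
    rw [div_le_iff₀' (by positivity)] at b1
    nlinarith

section Exponential

variable {E : Type*} [NormedAddCommGroup E] [NormedSpace ℝ E] [CompleteSpace E]

/-- The exponential of `t • Q` expanded in powers of `Q + b • 1`. -/
theorem hasSum_exp_smul_apply (Q : E →L[ℝ] E) (b t : ℝ) (x : E) :
    HasSum (fun n : ℕ => (Real.exp (-(t * b)) * t ^ n / n.factorial) • ((Q + b • 1) ^ n) x)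
      (NormedSpace.exp (t • Q) x) := by
  let _ : NormedAlgebra ℚ (E →L[ℝ] E) := NormedAlgebra.restrictScalars ℚ ℝ (E →L[ℝ] E)
  set V : E →L[ℝ] E := Q + b • 1 with hV
  have e : t • Q = algebraMap ℝ (E →L[ℝ] E) (-(t * b)) + t • V := by
    rw [hV, Algebra.algebraMap_eq_smul_one]; module
  have e2 : NormedSpace.exp (t • Q) = Real.exp (-(t * b)) • NormedSpace.exp (t • V) := by
    rw [e, NormedSpace.exp_add_of_commute (Algebra.commutes _ _),
      ← NormedSpace.algebraMap_exp_comm, ← Real.exp_eq_exp_ℝ, ← Algebra.smul_def]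
  have h := (NormedSpace.exp_series_hasSum_exp' (𝕂 := ℝ) (t • V)).const_smul
    (Real.exp (-(t * b)))
  rw [← e2] at h
  convert! h.mapL (ContinuousLinearMap.apply ℝ E x) using 2 with n
  simp only [ContinuousLinearMap.apply_apply, _root_.smul_apply, smul_pow, smul_smul]
  congr 1
  ring

/-- The derivative `Q * exp Q` expanded in powers of `Q + b • 1`. -/
theorem hasSum_mul_exp_apply (Q : E →L[ℝ] E) (b : ℝ) (x : E) :
    HasSum (fun n : ℕ => (Real.exp (-b) * (n - b) / n.factorial) • ((Q + b • 1) ^ n) x)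
      ((Q * NormedSpace.exp Q) x) := by
  set V : E →L[ℝ] E := Q + b • 1 with hV
  have h : HasSum (fun n : ℕ => (Real.exp (-b) / n.factorial) • (V ^ n) x)
      (NormedSpace.exp Q x) := by
    simpa only [one_mul, one_pow, mul_one, one_smul] using hasSum_exp_smul_apply Q b 1 x
  have h1 : HasSum (fun n : ℕ => (Real.exp (-b) * n / n.factorial) • (V ^ n) x)
      (V (NormedSpace.exp Q x)) := by
    rw [← hasSum_nat_add_iff' 1]
    convert h.mapL V using 2 with n
    · rw [map_smul, pow_succ', mul_apply_eq_comp]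
      congr 1
      rw [Nat.factorial_succ]
      push_cast
      field_simp
    · simp
  convert h1.sub (h.const_smul b) using 2 with n
  · rw [smul_smul, ← sub_smul]
    congr 1
    ring
  · simp [hV]

end Exponential

/-- Analyticity-type estimate for a positive semigroup whose generator dominates `-a ^ 2`. -/
theorem norm_mul_exp_le {E : Type*} [NormedAddCommGroup E] [Lattice E] [HasSolidNorm E]
    [IsOrderedAddMonoid E] [NormedSpace ℝ E] [PosSMulStrictMono ℝ E] [CompleteSpace E]
    {Q : E →L[ℝ] E} {a M : ℝ} (ha : 2 ≤ a) (hQ : ∀ x : E, 0 ≤ x → 0 ≤ Q x + a ^ 2 • x)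
    (hM : ∀ t : ℝ, 0 ≤ t → ‖NormedSpace.exp (t • Q)‖ ≤ M) :
    ‖Q * NormedSpace.exp Q‖ ≤ 16 * a * M := by
  have ha0 : 0 < a := by linarith
  have hpow : ∀ (n : ℕ) (x : E), 0 ≤ x → 0 ≤ ((Q + a ^ 2 • 1) ^ n) x := by
    intro n
    induction n with
    | zero => intro x hx; simpa using hx
    | succ n ih =>
      intro x hx
      rw [pow_succ, mul_apply_eq_comp]
      exact ih _ (by simpa using hQ x hx)
  set P : E →L[ℝ] E := (8 * a) • (NormedSpace.exp ((1 + a⁻¹) • Q) +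
    NormedSpace.exp ((1 - a⁻¹) • Q)) with hP
  have hPsum (x : E) := ((hasSum_exp_smul_apply Q (a ^ 2) (1 + a⁻¹) x).add
    (hasSum_exp_smul_apply Q (a ^ 2) (1 - a⁻¹) x)).const_smul (8 * a)
  have hw : ∀ n : ℕ, ∀ c : ℝ, c ≤ |n - a ^ 2| → Real.exp (-a ^ 2) * c / n.factorial ≤
      8 * a * (Real.exp (-((1 + a⁻¹) * a ^ 2)) * (1 + a⁻¹) ^ n / n.factorial +
        Real.exp (-((1 - a⁻¹) * a ^ 2)) * (1 - a⁻¹) ^ n / n.factorial) := by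
    intro n c hc
    rw [← add_div, ← mul_div_assoc]
    refine div_le_div_of_nonneg_right ?_ (by positivity)
    exact (mul_le_mul_of_nonneg_left hc (Real.exp_pos _).le).trans (exp_mul_abs_sub_le ha n)
  have hSP : ‖Q * NormedSpace.exp Q‖ ≤ ‖P‖ := by
    refine opNorm_le_of_dominated (fun x hx => ?_) fun x hx => ?_
    · refine hasSum_le (fun n => ?_) (hasSum_mul_exp_apply Q (a ^ 2) x) (hPsum x)
      rw [← add_smul, smul_smul]
      exact smul_le_smul_of_nonneg_right (hw n _ (le_abs_self _)) (hpow n x hx)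
    · refine hasSum_le (fun n => ?_) (hasSum_mul_exp_apply Q (a ^ 2) x).neg (hPsum x)
      rw [← add_smul, smul_smul, ← neg_smul]
      refine smul_le_smul_of_nonneg_right (le_of_eq_of_le ?_ (hw n _ (neg_le_abs _)))
        (hpow n x hx)
      ring
  have hinv : a⁻¹ ≤ 1 := inv_le_one_of_one_le₀ (by linarith)
  calc ‖Q * NormedSpace.exp Q‖ ≤ ‖P‖ := hSP
    _ ≤ 8 * a * (M + M) := by
      rw [hP, norm_smul, Real.norm_of_nonneg (by positivity)]
      gcongr
      exact (norm_add_le _ _).trans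
        (add_le_add (hM _ (by positivity)) (hM _ (sub_nonneg.2 hinv)))
    _ = 16 * a * M := by ring


/-- **Theorem (main result, real version).**
For every real number `M ≥ 1` there exists a constant `C = C(M) ∈ [0,∞)`, depending only
on `M`, such that: for every real Banach lattice `E` and every bounded linear operator `Q`
on `E` for which `e^{tQ}` is positive for all `t ≥ 0` and
`sup_{t ∈ [-1,∞)} ‖e^{tQ}‖ ≤ M`, one has `‖Q‖ ≤ C`. -/
theorem decoupled_markov_group_banach_lattice (M : ℝ) (hM : 1 ≤ M) :
    ∃ C : ℝ, 0 ≤ C ∧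
      ∀ (E : Type*) [NormedAddCommGroup E] [Lattice E] [HasSolidNorm E] [IsOrderedAddMonoid E]
        [NormedSpace ℝ E] [PosSMulStrictMono ℝ E] [PosSMulReflectLT ℝ E]
        [CompleteSpace E] (Q : E →L[ℝ] E),
        (∀ t : ℝ, 0 ≤ t → ∀ x : E, 0 ≤ x → 0 ≤ NormedSpace.exp (t • Q) x) →
        (∀ t : ℝ, -1 ≤ t → ‖NormedSpace.exp (t • Q)‖ ≤ M) →
        ‖Q‖ ≤ C := by
  refine ⟨512 * M ^ 4, by positivity, ?_⟩
  intro E _ _ _ _ _ _ _ _ Q hpos hbd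
  have hM4 : 1 ≤ M ^ 4 := one_le_pow₀ hM
  rcases lt_or_ge ‖Q‖ 2 with hQ | hQ
  · linarith
  set a : ℝ := √(2 * ‖Q‖) with ha
  have ha2 : a ^ 2 = 2 * ‖Q‖ := Real.sq_sqrt (by positivity)
  have h2a : 2 ≤ a := Real.le_sqrt_of_sq_le (by linarith)
  have hS : ‖Q * NormedSpace.exp Q‖ ≤ 16 * a * M :=
    norm_mul_exp_le h2a
      (fun x hx => add_smul_nonneg_of_exp_nonneg hpos (by rw [ha2]; linarith) hx)
      fun t ht => hbd t (by linarith)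
  have hinv : NormedSpace.exp Q * NormedSpace.exp (-Q) = 1 := by
    let _ : NormedAlgebra ℚ (E →L[ℝ] E) := NormedAlgebra.restrictScalars ℚ ℝ (E →L[ℝ] E)
    rw [← NormedSpace.exp_add_of_commute (Commute.refl Q).neg_right, add_neg_cancel,
      NormedSpace.exp_zero]
  have hneg : ‖NormedSpace.exp (-Q)‖ ≤ M := by simpa using hbd (-1) le_rfl
  have hQa : ‖Q‖ ≤ 16 * a * M * M :=
    calc ‖Q‖ = ‖Q * NormedSpace.exp Q * NormedSpace.exp (-Q)‖ := by
          rw [mul_assoc, hinv, mul_one]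
      _ ≤ ‖Q * NormedSpace.exp Q‖ * ‖NormedSpace.exp (-Q)‖ := norm_mul_le _ _
      _ ≤ 16 * a * M * M := by gcongr
  have haM : a ≤ 32 * M ^ 2 := by
    refine le_of_mul_le_mul_left ?_ (show 0 < a by linarith)
    nlinarith
  nlinarith [mul_le_mul_of_nonneg_right haM (show 0 ≤ 16 * M * M by positivity)]
end

section
/- For every real number M ≥ 1 there exists a constant C = C(M) ∈ [0,∞), depending only on M, with the following property: for every bounded linear operator Q on the real sequence space ℓ¹ = ℓ¹(ℕ; ℝ) such that the operator exponential e^{tQ} is a positive operator for every t ∈ [0,∞) (i.e., e^{tQ}x has all coordinates ≥ 0 whenever x has all coordinates ≥ 0) and such that sup_{t ∈ [-1,∞)} ‖e^{tQ}‖ ≤ M, one has ‖Q‖ ≤ C. -/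
open NormedSpace in
/-- Adding a scalar to the exponent multiplies the exponential by a scalar. -/
theorem exp_smul_add_smul_one {A : Type*} [NormedRing A] [NormedAlgebra ℝ A] [CompleteSpace A]
    (Q : A) (c t : ℝ) :
    exp (t • (Q + c • (1 : A))) = Real.exp (t * c) • exp (t • Q) := by
  have hcomm : Commute (algebraMap ℝ A (t * c)) (t • Q) := Algebra.commutes _ _
  have hsplit : t • (Q + c • (1 : A)) = algebraMap ℝ A (t * c) + t • Q := by
    rw [Algebra.algebraMap_eq_smul_one, smul_add, smul_smul, add_comm]
  rw [hsplit, exp_add_of_commute_of_mem_ball (𝕂 := ℝ) hcomm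
    ((expSeries_radius_eq_top ℝ A).symm ▸ edist_lt_top _ _)
    ((expSeries_radius_eq_top ℝ A).symm ▸ edist_lt_top _ _), ← algebraMap_exp_comm (𝕂 := ℝ),
    ← Algebra.smul_def, Real.exp_eq_exp_ℝ]

open NormedSpace in
theorem exp_mul_exp_neg_one_smul {A : Type*} [NormedRing A] [NormedAlgebra ℝ A] [CompleteSpace A]
    (Q : A) : exp Q * exp ((-1 : ℝ) • Q) = 1 := by
  rw [← exp_add_of_commute_of_mem_ball (𝕂 := ℝ) ((Commute.refl Q).smul_right (-1 : ℝ))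
    ((expSeries_radius_eq_top ℝ A).symm ▸ edist_lt_top _ _)
    ((expSeries_radius_eq_top ℝ A).symm ▸ edist_lt_top _ _)]
  simp

/-- The deviation of `n` from `s ^ 2` is dominated by the likelihood ratios of the Poisson weights
with means `s ^ 2 ± s` relative to the one with mean `s ^ 2`. -/
theorem abs_sub_sq_le_exp_mul {s : ℝ} (hs : 2 ≤ s) (n : ℕ) :
    |(n : ℝ) - s ^ 2| ≤ Real.exp 2 * s *
      (Real.exp (-s) * (1 + s⁻¹) ^ n + Real.exp s * (1 - s⁻¹) ^ n) := by
  have hs0 : 0 < s := by linarith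
  obtain ⟨x, hx⟩ : ∃ x, x = s⁻¹ := ⟨_, rfl⟩
  have hx0 : 0 < x := hx ▸ inv_pos.2 hs0
  have hx2 : x ≤ 1 / 2 := by rw [hx, inv_le_comm₀ hs0 (by norm_num)]; linarith
  have hsx : s * x = 1 := by rw [hx, mul_inv_cancel₀ hs0.ne']
  rw [← hx]
  have key : ∀ a y : ℝ, -1 < y → 0 ≤ a - 1 + a * y → Real.exp (y - a * y ^ 2) ≤ 1 + y := by
    intro a y hy hay
    have hpos : 0 < 1 + y := by linarith
    rw [← Real.le_log_iff_exp_le hpos]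
    refine le_trans ?_ (Real.one_sub_inv_le_log_of_pos hpos)
    have : 1 - (1 + y)⁻¹ = y / (1 + y) := by field_simp; ring
    rw [this, le_div_iff₀ hpos]
    nlinarith [mul_nonneg (sq_nonneg y) hay]
  have hn : (0 : ℝ) ≤ n := n.cast_nonneg
  have hA : 0 ≤ Real.exp (-s) * (1 + x) ^ n := by positivity
  have hB : 0 ≤ Real.exp s * (1 - x) ^ n :=
    mul_nonneg (Real.exp_pos _).le (pow_nonneg (by linarith) _)
  have hsxs : s ^ 2 * x = s := by rw [sq, mul_assoc, hsx, mul_one]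
  have hsxx : s ^ 2 * x ^ 2 = 1 := by rw [← mul_pow, hsx, one_pow]
  suffices h : |(n : ℝ) - s ^ 2| * x ≤
      Real.exp 2 * (Real.exp (-s) * (1 + x) ^ n + Real.exp s * (1 - x) ^ n) by
    have h' := mul_le_mul_of_nonneg_left h hs0.le
    linear_combination h' - |(n : ℝ) - s ^ 2| * hsx
  have hE : (1 : ℝ) + 1 ≤ Real.exp 1 := Real.add_one_le_exp 1
  rcases le_total (s ^ 2) n with h | h
  · rw [abs_of_nonneg (by linarith)]
    have hpow : Real.exp (n * (x - 1 * x ^ 2)) ≤ (1 + x) ^ n := by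
      rw [Real.exp_nat_mul]
      exact pow_le_pow_left₀ (Real.exp_pos _).le (key 1 x (by linarith) (by linarith)) n
    have hk : (n - s ^ 2) * x / 2 ≤ (n - s ^ 2) * x * (1 - x) := by
      have : 0 ≤ (n - s ^ 2) * x := mul_nonneg (by linarith) hx0.le
      nlinarith
    calc (n - s ^ 2) * x ≤ Real.exp 1 * ((n - s ^ 2) * x * (1 - x) + 1) := by
          nlinarith [mul_nonneg (sub_nonneg.2 h) hx0.le]
      _ ≤ Real.exp 1 * Real.exp ((n - s ^ 2) * x * (1 - x)) := by
          gcongr; exact Real.add_one_le_exp _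
      _ = Real.exp 2 * (Real.exp (-s) * Real.exp (n * (x - 1 * x ^ 2))) := by
          simp only [← Real.exp_add]
          congr 1
          linear_combination -hsxs + hsxx
      _ ≤ Real.exp 2 * (Real.exp (-s) * (1 + x) ^ n) := by gcongr
      _ ≤ _ := by gcongr; linarith
  · rw [abs_of_nonpos (by linarith)]
    have hpow : Real.exp (n * (-x - 2 * (-x) ^ 2)) ≤ (1 - x) ^ n := by
      rw [Real.exp_nat_mul]
      exact pow_le_pow_left₀ (Real.exp_pos _).le
        (key 2 (-x) (by linarith) (by linarith)) n
    have hk : 0 ≤ (s ^ 2 - n) * x ^ 2 := mul_nonneg (by linarith) (sq_nonneg x)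
    calc -(n - s ^ 2) * x ≤ (s ^ 2 - n) * x + 2 * ((s ^ 2 - n) * x ^ 2) + 1 := by linarith
      _ ≤ Real.exp ((s ^ 2 - n) * x + 2 * ((s ^ 2 - n) * x ^ 2)) := Real.add_one_le_exp _
      _ = Real.exp 2 * (Real.exp s * Real.exp (n * (-x - 2 * (-x) ^ 2))) := by
          simp only [← Real.exp_add]
          congr 1
          linear_combination hsxs + 2 * hsxx
      _ ≤ Real.exp 2 * (Real.exp s * (1 - x) ^ n) := by gcongr
      _ ≤ _ := by gcongr; linarith

open NormedSpace Nat in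
/-- If the powers of `Q + s ^ 2` are nonnegative under a functional, then the derivative of
`t ↦ exp (t • Q)` at `1` is controlled by the values of this function at `1 ± s⁻¹`. -/
theorem abs_apply_mul_exp_le {A : Type*} [NormedRing A] [NormedAlgebra ℝ A] [CompleteSpace A]
    (L : A →L[ℝ] ℝ) (Q : A) {s : ℝ} (hs : 2 ≤ s)
    (hL : ∀ n : ℕ, 0 ≤ L ((Q + s ^ 2 • (1 : A)) ^ n)) :
    |L (Q * exp Q)| ≤ Real.exp 2 * s *
      (L (exp ((1 + s⁻¹) • Q)) + L (exp ((1 - s⁻¹) • Q))) := by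
  have hs0 : s ≠ 0 := by linarith
  set P := Q + s ^ 2 • (1 : A) with hP
  have hsum : ∀ t : ℝ, HasSum (fun n : ℕ => t ^ n * ((n ! : ℝ)⁻¹ * L (P ^ n)))
      (Real.exp (t * s ^ 2) * L (exp (t • Q))) := fun t => by
    have h := L.hasSum (exp_series_hasSum_exp' (𝕂 := ℝ) (t • P))
    rw [hP, exp_smul_add_smul_one, ← hP] at h
    simpa [smul_pow, mul_left_comm] using h
  have hderiv : HasSum (fun n : ℕ => (n : ℝ) * ((n ! : ℝ)⁻¹ * L (P ^ n))) (L (P * exp P)) := by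
    have h := L.hasSum ((exp_series_hasSum_exp' (𝕂 := ℝ) P).mul_left P)
    rw [← hasSum_nat_add_iff' 1]
    simp only [Finset.range_one, Finset.sum_singleton, Nat.cast_zero, zero_mul, sub_zero]
    refine Eq.subst (motive := fun f : ℕ → ℝ => HasSum f _) (funext fun n => ?_) h
    rw [mul_smul_comm, map_smul, ← pow_succ' P n, Nat.factorial_succ]
    have : (n ! : ℝ) ≠ 0 := by positivity
    have : (n : ℝ) + 1 ≠ 0 := by positivity
    push_cast
    simp only [smul_eq_mul]
    field_simp
  have hexpP : exp P = Real.exp (s ^ 2) • exp Q := by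
    simpa using exp_smul_add_smul_one Q (s ^ 2) 1
  have hleft : HasSum (fun n : ℕ => ((n : ℝ) - s ^ 2) * ((n ! : ℝ)⁻¹ * L (P ^ n)))
      (Real.exp (s ^ 2) * L (Q * exp Q)) := by
    have h := hderiv.sub ((hsum 1).mul_left (s ^ 2))
    have hval : L (P * exp P) - s ^ 2 * (Real.exp (1 * s ^ 2) * L (exp ((1 : ℝ) • Q))) =
        Real.exp (s ^ 2) * L (Q * exp Q) := by
      rw [hexpP, mul_smul_comm, hP, add_mul]
      simp
      ring
    rw [hval] at h
    simpa [sub_mul] using h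
  have hright : HasSum (fun n : ℕ => Real.exp 2 * s *
      (Real.exp (-s) * (1 + s⁻¹) ^ n + Real.exp s * (1 - s⁻¹) ^ n) * ((n ! : ℝ)⁻¹ * L (P ^ n)))
      (Real.exp (s ^ 2) * (Real.exp 2 * s *
        (L (exp ((1 + s⁻¹) • Q)) + L (exp ((1 - s⁻¹) • Q))))) := by
    have h := (((hsum (1 + s⁻¹)).mul_left (Real.exp (-s))).add
      ((hsum (1 - s⁻¹)).mul_left (Real.exp s))).mul_left (Real.exp 2 * s)
    have e1 : Real.exp (-s) * Real.exp ((1 + s⁻¹) * s ^ 2) = Real.exp (s ^ 2) := by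
      rw [← Real.exp_add]; congr 1; field_simp; ring
    have e2 : Real.exp s * Real.exp ((1 - s⁻¹) * s ^ 2) = Real.exp (s ^ 2) := by
      rw [← Real.exp_add]; congr 1; field_simp; ring
    rw [← mul_assoc (Real.exp (-s)), ← mul_assoc (Real.exp s), e1, e2, ← mul_add,
      mul_left_comm (Real.exp 2 * s)] at h
    refine Eq.subst (motive := fun f : ℕ → ℝ => HasSum f _) (funext fun n => ?_) h
    ring
  have hle := tsum_of_norm_bounded hright (f := fun n : ℕ =>
    ((n : ℝ) - s ^ 2) * ((n ! : ℝ)⁻¹ * L (P ^ n))) fun n => by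
      have hn : 0 ≤ (n ! : ℝ)⁻¹ * L (P ^ n) := mul_nonneg (by positivity) (hL n)
      rw [Real.norm_eq_abs, abs_mul, abs_of_nonneg hn]
      exact mul_le_mul_of_nonneg_right (abs_sub_sq_le_exp_mul hs n) hn
  rw [hleft.tsum_eq, Real.norm_eq_abs, abs_mul, abs_of_pos (Real.exp_pos _)] at hle
  exact le_of_mul_le_mul_left hle (Real.exp_pos _)

open NormedSpace in
/-- The generator of a norm continuous positive semigroup on `ℓ¹` becomes positive after adding
its norm. -/
theorem apply_add_norm_smul_nonneg (Q : lp (fun _ : ℕ => ℝ) 1 →L[ℝ] lp (fun _ : ℕ => ℝ) 1)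
    (hpos : ∀ t : ℝ, 0 ≤ t → ∀ x : lp (fun _ : ℕ => ℝ) 1, (∀ n : ℕ, 0 ≤ x n) →
      ∀ n : ℕ, 0 ≤ (exp (t • Q)) x n)
    (x : lp (fun _ : ℕ => ℝ) 1) (hx : ∀ n : ℕ, 0 ≤ x n) (j : ℕ) :
    0 ≤ (Q + ‖Q‖ • (1 : lp (fun _ : ℕ => ℝ) 1 →L[ℝ] lp (fun _ : ℕ => ℝ) 1)) x j := by
  have off : ∀ w : lp (fun _ : ℕ => ℝ) 1, (∀ n : ℕ, 0 ≤ w n) → w j = 0 → 0 ≤ Q w j := by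
    intro w hw hwj
    let L : (lp (fun _ : ℕ => ℝ) 1 →L[ℝ] lp (fun _ : ℕ => ℝ) 1) →L[ℝ] ℝ :=
      (lp.evalCLM ℝ (fun _ : ℕ => ℝ) 1 j).comp (ContinuousLinearMap.apply ℝ _ w)
    have hd := L.hasFDerivAt.comp_hasDerivAt (0 : ℝ) (hasDerivAt_exp_smul_const' (𝕂 := ℝ) Q 0)
    have hval : L (Q * exp ((0 : ℝ) • Q)) = Q w j := by
      rw [zero_smul, exp_zero, mul_one]; rfl
    rw [hval] at hd
    refine ge_of_tendsto hd.tendsto_slope_zero_right ?_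
    filter_upwards [self_mem_nhdsWithin] with t ht
    have ht0 : 0 < t := ht
    have h0 : L (exp ((0 : ℝ) • Q)) = 0 := by
      rw [zero_smul, exp_zero]; exact hwj
    simp only [Function.comp_apply, h0, zero_add, sub_zero, smul_eq_mul]
    exact mul_nonneg (inv_nonneg.2 ht0.le) (hpos t ht0.le w hw j)
  have hdiag : -‖Q‖ ≤ Q (lp.single 1 j (1 : ℝ)) j := by
    have h1 := lp.norm_apply_le_norm one_ne_zero (Q (lp.single 1 j (1 : ℝ))) j
    have h2 := Q.le_opNorm (lp.single 1 j (1 : ℝ))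
    rw [lp.norm_single one_pos, norm_one, mul_one] at h2
    rw [Real.norm_eq_abs] at h1
    linarith [neg_abs_le (Q (lp.single 1 j (1 : ℝ)) j)]
  have hcoord : ∀ n, (x - x j • lp.single (E := fun _ : ℕ => ℝ) 1 j (1 : ℝ)) n =
      x n - x j * lp.single (E := fun _ : ℕ => ℝ) 1 j (1 : ℝ) n := fun n => rfl
  have hoff := off (x - x j • lp.single 1 j (1 : ℝ)) (fun n => by
    rw [hcoord]
    by_cases hn : n = j
    · subst hn; simp
    · simp [hn, hx n]) (by rw [hcoord]; simp)
  rw [map_sub, map_smul] at hoff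
  have hoff' : 0 ≤ Q x j - x j * Q (lp.single 1 j (1 : ℝ)) j := hoff
  have : 0 ≤ Q x j + ‖Q‖ * x j := by nlinarith [hx j]
  exact this


/-- **Decoupled Markov group conjecture on `ℓ¹`.**
For every `M ≥ 1` there is a constant `C = C(M) ∈ [0,∞)` such that every bounded linear
operator `Q` on `ℓ¹ = ℓ¹(ℕ; ℝ)` whose exponentials `e^{tQ}` are positive (coordinatewise)
for all `t ≥ 0` and satisfy `sup_{t ∈ [-1,∞)} ‖e^{tQ}‖ ≤ M` has norm `‖Q‖ ≤ C`. -/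
theorem decoupled_markov_group_ell_one (M : ℝ) (hM : 1 ≤ M) :
    ∃ C : ℝ, 0 ≤ C ∧
      ∀ Q : lp (fun _ : ℕ => ℝ) 1 →L[ℝ] lp (fun _ : ℕ => ℝ) 1,
        (∀ t : ℝ, 0 ≤ t → ∀ x : lp (fun _ : ℕ => ℝ) 1, (∀ n : ℕ, 0 ≤ x n) →
          ∀ n : ℕ, 0 ≤ (NormedSpace.exp (t • Q)) x n) →
        (∀ t : ℝ, -1 ≤ t → ‖NormedSpace.exp (t • Q)‖ ≤ M) →
        ‖Q‖ ≤ C := by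
  refine ⟨max 4 ((4 * Real.exp 2 * M ^ 2) ^ 2), by positivity, fun Q hpos hM' => ?_⟩
  by_contra! hC
  obtain ⟨h4, hbig⟩ := max_lt_iff.1 hC
  obtain ⟨s, hs⟩ : ∃ s, s = √‖Q‖ := ⟨_, rfl⟩
  have hsq : s ^ 2 = ‖Q‖ := by rw [hs, Real.sq_sqrt (norm_nonneg _)]
  have hs2 : 2 ≤ s := by rw [hs]; exact Real.le_sqrt_of_sq_le (by linarith)
  have hs1 : 0 < s⁻¹ ∧ s⁻¹ ≤ 1 := ⟨by positivity, inv_le_one_of_one_le₀ (by linarith)⟩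
  have hpow : ∀ n : ℕ, ∀ x : lp (fun _ : ℕ => ℝ) 1, (∀ k : ℕ, 0 ≤ x k) → ∀ j : ℕ,
      0 ≤ ((Q + s ^ 2 • (1 : lp (fun _ : ℕ => ℝ) 1 →L[ℝ] lp (fun _ : ℕ => ℝ) 1)) ^ n) x j := by
    intro n
    induction n with
    | zero => intro x hx j; simpa using hx j
    | succ n ih =>
      intro x hx j
      rw [pow_succ, mul_apply_eq_comp, hsq]
      rw [hsq] at ih
      exact ih _ (apply_add_norm_smul_nonneg Q hpos x hx) j
  have hbound : ∀ x : lp (fun _ : ℕ => ℝ) 1, (∀ k : ℕ, 0 ≤ x k) →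
      ‖(Q * NormedSpace.exp Q) x‖ ≤ 2 * Real.exp 2 * s * M * ‖x‖ := by
    intro x hx
    set T₁ := NormedSpace.exp ((1 + s⁻¹) • Q) with hT₁
    set T₂ := NormedSpace.exp ((1 - s⁻¹) • Q) with hT₂
    have hle : ‖(Q * NormedSpace.exp Q) x‖ ≤ ‖(Real.exp 2 * s) • (T₁ x + T₂ x)‖ := by
      refine lp.norm_mono one_ne_zero fun j => ?_
      refine le_trans ?_ (Real.le_norm_self _)
      exact abs_apply_mul_exp_le ((lp.evalCLM ℝ (fun _ : ℕ => ℝ) 1 j).comp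
        (ContinuousLinearMap.apply ℝ _ x)) Q hs2 fun n => hpow n x hx j
    have h1 : ‖T₁ x‖ ≤ M * ‖x‖ := T₁.le_of_opNorm_le (hM' _ (by linarith)) x
    have h2 : ‖T₂ x‖ ≤ M * ‖x‖ := T₂.le_of_opNorm_le (hM' _ (by linarith)) x
    calc ‖(Q * NormedSpace.exp Q) x‖ ≤ ‖(Real.exp 2 * s) • (T₁ x + T₂ x)‖ := hle
      _ = Real.exp 2 * s * ‖T₁ x + T₂ x‖ := by
        rw [norm_smul, Real.norm_of_nonneg (by positivity)]
      _ ≤ Real.exp 2 * s * (M * ‖x‖ + M * ‖x‖) := by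
        gcongr
        exact (norm_add_le _ _).trans (add_le_add h1 h2)
      _ = 2 * Real.exp 2 * s * M * ‖x‖ := by ring
  have hderiv : ‖Q * NormedSpace.exp Q‖ ≤ 4 * Real.exp 2 * s * M := by
    refine ContinuousLinearMap.opNorm_le_bound _ (by positivity) fun x => ?_
    have hu := lp.norm_toNorm (x := x)
    set u := lp.toNorm x with hu'
    have hun : ∀ k, u k = |x k| := fun k => rfl
    have hp : ‖(1 / 2 : ℝ) • (u + x)‖ ≤ ‖x‖ := by
      rw [norm_smul, Real.norm_of_nonneg (by norm_num)]
      linarith [norm_add_le u x]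
    have hm : ‖(1 / 2 : ℝ) • (u - x)‖ ≤ ‖x‖ := by
      rw [norm_smul, Real.norm_of_nonneg (by norm_num)]
      linarith [norm_sub_le u x]
    have hx : x = (1 / 2 : ℝ) • (u + x) - (1 / 2 : ℝ) • (u - x) := by module
    have hbp := hbound ((1 / 2 : ℝ) • (u + x)) fun k => by
      have : 0 ≤ 1 / 2 * (u k + x k) := by rw [hun]; linarith [neg_abs_le (x k)]
      exact this
    have hbm := hbound ((1 / 2 : ℝ) • (u - x)) fun k => by
      have : 0 ≤ 1 / 2 * (u k - x k) := by rw [hun]; linarith [le_abs_self (x k)]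
      exact this
    have hK : 0 ≤ 2 * Real.exp 2 * s * M := by positivity
    calc ‖(Q * NormedSpace.exp Q) x‖
        = ‖(Q * NormedSpace.exp Q) ((1 / 2 : ℝ) • (u + x)) -
            (Q * NormedSpace.exp Q) ((1 / 2 : ℝ) • (u - x))‖ := by rw [← map_sub, ← hx]
      _ ≤ 2 * Real.exp 2 * s * M * ‖x‖ + 2 * Real.exp 2 * s * M * ‖x‖ :=
        (norm_sub_le _ _).trans (add_le_add
          (hbp.trans (mul_le_mul_of_nonneg_left hp hK))
          (hbm.trans (mul_le_mul_of_nonneg_left hm hK)))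
      _ = 4 * Real.exp 2 * s * M * ‖x‖ := by ring
  have hinv : NormedSpace.exp Q * NormedSpace.exp ((-1 : ℝ) • Q) = 1 := 
    exp_mul_exp_neg_one_smul Q
  have hQ : ‖Q‖ ≤ 4 * Real.exp 2 * s * M * M := by
    calc ‖Q‖ = ‖Q * NormedSpace.exp Q * NormedSpace.exp ((-1 : ℝ) • Q)‖ := by
          rw [mul_assoc, hinv, mul_one]
      _ ≤ ‖Q * NormedSpace.exp Q‖ * ‖NormedSpace.exp ((-1 : ℝ) • Q)‖ := norm_mul_le _ _
      _ ≤ 4 * Real.exp 2 * s * M * M :=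
        mul_le_mul hderiv (hM' _ le_rfl) (norm_nonneg _) (by positivity)
  have hsle : s ≤ 4 * Real.exp 2 * M ^ 2 := by
    rw [← hsq] at hQ
    nlinarith
  rw [← hsq] at hbig
  nlinarith [pow_le_pow_left₀ (by linarith) hsle 2]
end

section
/- For every real number M ≥ 1 there exists a constant C = C(M) ∈ [0,∞), depending only on M (and in particular not on the dimension d), with the following property: for every d ∈ ℕ and every matrix Q ∈ ℝ^{d×d} such that ‖e^{-Q}‖ ≤ M and such that the matrix exponential e^{tQ} is column stochastic for every t ∈ [0,∞), one has ‖Q‖ ≤ C. -/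
open scoped Matrix

/-- The linear map `x ↦ A *ᵥ x` as a continuous linear map on `ℝ^d` endowed with
the `1`-norm `‖x‖₁ = ∑ i, |x i|`. -/
noncomputable def Matrix.toL1CLM {d : ℕ} (A : Matrix (Fin d) (Fin d) ℝ) :
    PiLp 1 (fun _ : Fin d => ℝ) →L[ℝ] PiLp 1 (fun _ : Fin d => ℝ) :=
  LinearMap.toContinuousLinearMap <|
    (WithLp.linearEquiv 1 ℝ (∀ _ : Fin d, ℝ)).symm.toLinearMap ∘ₗ
      A.mulVecLin ∘ₗ (WithLp.linearEquiv 1 ℝ (∀ _ : Fin d, ℝ)).toLinearMap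

/-- The operator norm of a square matrix induced by the `1`-norm on `ℝ^d`. -/
noncomputable def Matrix.l1OpNorm {d : ℕ} (A : Matrix (Fin d) (Fin d) ℝ) : ℝ :=
  ‖A.toL1CLM‖

/-- A square matrix is column stochastic if all its entries are nonnegative and
each of its columns sums to `1`. -/
def Matrix.ColumnStochastic {d : ℕ} (A : Matrix (Fin d) (Fin d) ℝ) : Prop :=
  (∀ i j, 0 ≤ A i j) ∧ ∀ j, ∑ i, A i j = 1

theorem Real.hasSum_natCast_mul_of_hasSum_pow_div_factorial (c : ℝ) {g : ℕ → ℝ} {a : ℝ}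
    (hg : HasSum (fun k : ℕ => g (k + 1) * (c ^ k / (k.factorial : ℝ))) a) :
    HasSum (fun k : ℕ => (k : ℝ) * g k * (c ^ k / (k.factorial : ℝ))) (c * a) := by
  rw [← hasSum_nat_add_iff' 1]
  simp only [Finset.range_one, Finset.sum_singleton, Nat.cast_zero, zero_mul, sub_zero]
  refine (congrArg (HasSum · _) (funext fun k => ?_)).mpr (hg.mul_left c)
  rw [Nat.factorial_succ]
  push_cast
  field_simp
  ring

/-- The second central moment of the Poisson distribution, without normalization. -/
theorem Real.hasSum_sub_sq_mul_pow_div_factorial (c : ℝ) :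
    HasSum (fun k : ℕ => ((k : ℝ) - c) ^ 2 * (c ^ k / (k.factorial : ℝ))) (c * Real.exp c) := by
  have h0 : HasSum (fun k : ℕ => c ^ k / (k.factorial : ℝ)) (Real.exp c) := by
    rw [Real.exp_eq_exp_ℝ]
    exact NormedSpace.expSeries_div_hasSum_exp c
  have h1 := Real.hasSum_natCast_mul_of_hasSum_pow_div_factorial c (g := fun _ => 1)
    (by simpa using h0)
  have h2 := Real.hasSum_natCast_mul_of_hasSum_pow_div_factorial c (g := fun k => (k : ℝ) - 1)
    (by simpa using h1)
  convert (h2.add (h1.mul_left (1 - 2 * c))).add (h0.mul_left (c ^ 2)) using 1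
  · ext k; ring
  · ring

theorem norm_pow_le_one_of_norm_le_one {𝔸 : Type*} [NormedRing 𝔸] {S : 𝔸}
    (h1 : ‖(1 : 𝔸)‖ ≤ 1) (hS : ‖S‖ ≤ 1) (k : ℕ) : ‖S ^ k‖ ≤ 1 := by
  rcases k.eq_zero_or_pos with rfl | hk
  · simpa using h1
  · exact (norm_pow_le' S hk).trans (pow_le_one₀ (norm_nonneg S) hS)

section BanachAlgebra

variable {𝔸 : Type*} [NormedRing 𝔸] [NormedAlgebra ℝ 𝔸] [CompleteSpace 𝔸]

theorem hasSum_smul_sub_one_mul_exp_smul (S : 𝔸) (c : ℝ) :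
    HasSum (fun k : ℕ => (((k : ℝ) - c) * (c ^ k / (k.factorial : ℝ))) • S ^ k)
      (c • (S - 1) * NormedSpace.exp (c • S)) := by
  have h0 : HasSum (fun k : ℕ => (c ^ k / (k.factorial : ℝ)) • S ^ k)
      (NormedSpace.exp (c • S)) := by
    refine (congrArg (HasSum · _) (funext fun k => ?_)).mpr
      (NormedSpace.exp_series_hasSum_exp' (𝕂 := ℝ) (c • S))
    rw [smul_pow, smul_smul, div_eq_inv_mul]
  have h1 : HasSum (fun k : ℕ => ((k : ℝ) * (c ^ k / (k.factorial : ℝ))) • S ^ k)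
      (c • S * NormedSpace.exp (c • S)) := by
    rw [← hasSum_nat_add_iff' 1]
    simp only [Finset.range_one, Finset.sum_singleton, Nat.cast_zero, zero_mul, zero_smul,
      sub_zero]
    refine (congrArg (HasSum · _) (funext fun k => ?_)).mpr (h0.mul_left (c • S))
    rw [smul_mul_smul_comm, ← pow_succ', Nat.factorial_succ]
    congr 1
    push_cast
    field_simp
    ring
  rw [smul_sub, sub_mul]
  refine (congrArg (HasSum · _) (funext fun k => ?_)).mpr (h1.sub (h0.mul_left (c • (1 : 𝔸))))
  rw [smul_mul_smul_comm, one_mul, ← sub_smul, sub_mul]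

/-- The generator `c • (S - 1)` of the Poisson semigroup of a contraction `S` satisfies
`‖c (S - 1) e^{c (S - 1)}‖ ≤ √c`. -/
theorem norm_smul_sub_one_mul_exp_le {S : 𝔸} (h1 : ‖(1 : 𝔸)‖ ≤ 1) (hS : ‖S‖ ≤ 1) {c : ℝ}
    (hc : 0 < c) :
    ‖c • (S - 1) * NormedSpace.exp (c • (S - 1))‖ ≤ √c := by
  have hs : 0 < √c := Real.sqrt_pos.mpr hc
  have hss : √c ^ 2 = c := Real.sq_sqrt hc.le
  have h0 : HasSum (fun k : ℕ => c ^ k / (k.factorial : ℝ)) (Real.exp c) := by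
    rw [Real.exp_eq_exp_ℝ]
    exact NormedSpace.expSeries_div_hasSum_exp c
  have hdom := ((Real.hasSum_sub_sq_mul_pow_div_factorial c).mul_left (1 / (2 * √c))).add
    (h0.mul_left (√c / 2))
  have hle : ‖c • (S - 1) * NormedSpace.exp (c • S)‖ ≤ √c * Real.exp c := by
    have := (hasSum_smul_sub_one_mul_exp_smul S c).norm_le_of_bounded hdom fun k => ?_
    · refine this.trans_eq ?_
      nth_rewrite 2 [← hss]
      field_simp
      ring
    · have hk : 0 ≤ c ^ k / (k.factorial : ℝ) := by positivity
      have hamgm : |(k : ℝ) - c| ≤ 1 / (2 * √c) * ((k : ℝ) - c) ^ 2 + √c / 2 := by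
        rw [← sq_abs]
        have : 0 ≤ (|(k : ℝ) - c| - √c) ^ 2 / (2 * √c) := by positivity
        have e : (|(k : ℝ) - c| - √c) ^ 2 / (2 * √c) =
            1 / (2 * √c) * |(k : ℝ) - c| ^ 2 + √c / 2 - |(k : ℝ) - c| := by
          field_simp
          ring
        linarith
      calc ‖(((k : ℝ) - c) * (c ^ k / (k.factorial : ℝ))) • S ^ k‖
          ≤ |(k : ℝ) - c| * (c ^ k / (k.factorial : ℝ)) * ‖S ^ k‖ := by
            rw [norm_smul, Real.norm_eq_abs, abs_mul, abs_of_nonneg hk]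
        _ ≤ |(k : ℝ) - c| * (c ^ k / (k.factorial : ℝ)) :=
            mul_le_of_le_one_right (by positivity) (norm_pow_le_one_of_norm_le_one h1 hS k)
        _ ≤ (1 / (2 * √c) * ((k : ℝ) - c) ^ 2 + √c / 2) * (c ^ k / (k.factorial : ℝ)) := by
            gcongr
        _ = _ := by ring
  have hexp : NormedSpace.exp (c • (S - 1)) = Real.exp (-c) • NormedSpace.exp (c • S) := by
    let _ : NormedAlgebra ℚ 𝔸 := NormedAlgebra.restrictScalars ℚ ℝ 𝔸
    have e : c • (S - 1) = algebraMap ℝ 𝔸 (-c) + c • S := by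
      rw [Algebra.algebraMap_eq_smul_one, smul_sub, neg_smul]
      abel
    rw [e, NormedSpace.exp_add_of_commute (Algebra.commutes _ _), ← NormedSpace.algebraMap_exp_comm,
      ← Real.exp_eq_exp_ℝ, Algebra.algebraMap_eq_smul_one, smul_one_mul]
  rw [hexp, mul_smul_comm, norm_smul, Real.norm_of_nonneg (Real.exp_pos _).le]
  calc Real.exp (-c) * ‖c • (S - 1) * NormedSpace.exp (c • S)‖
      ≤ Real.exp (-c) * (√c * Real.exp c) := by gcongr
    _ = √c := by
        rw [mul_left_comm, ← Real.exp_add, neg_add_cancel, Real.exp_zero, mul_one]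

/-- If `1 + c⁻¹ • Q` is a contraction, then `‖Q‖ ≤ √c * ‖e^{-Q}‖`. -/
theorem norm_le_sqrt_mul_norm_exp_neg {Q : 𝔸} (h1 : ‖(1 : 𝔸)‖ ≤ 1) {c : ℝ} (hc : 0 < c)
    (hS : ‖1 + c⁻¹ • Q‖ ≤ 1) : ‖Q‖ ≤ √c * ‖NormedSpace.exp (-Q)‖ := by
  let _ : NormedAlgebra ℚ 𝔸 := NormedAlgebra.restrictScalars ℚ ℝ 𝔸
  have hQ : c • (1 + c⁻¹ • Q - 1) = Q := by
    rw [add_sub_cancel_left, smul_inv_smul₀ hc.ne']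
  have h := norm_smul_sub_one_mul_exp_le h1 hS hc
  rw [hQ] at h
  calc ‖Q‖ = ‖Q * NormedSpace.exp Q * NormedSpace.exp (-Q)‖ := by
        rw [mul_assoc, ← NormedSpace.exp_add_of_commute (Commute.refl Q).neg_right, add_neg_cancel,
          NormedSpace.exp_zero, mul_one]
    _ ≤ ‖Q * NormedSpace.exp Q‖ * ‖NormedSpace.exp (-Q)‖ := norm_mul_le _ _
    _ ≤ √c * ‖NormedSpace.exp (-Q)‖ := by gcongr

end BanachAlgebra

namespace Matrix

variable {d : ℕ}

theorem toL1CLM_apply (A : Matrix (Fin d) (Fin d) ℝ) (x : PiLp 1 (fun _ : Fin d => ℝ))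
    (i : Fin d) : A.toL1CLM x i = ∑ j, A i j * x j :=
  rfl

/-- `Matrix.toL1CLM` as a homomorphism of algebras. -/
noncomputable def toL1CLMHom (d : ℕ) : Matrix (Fin d) (Fin d) ℝ →ₐ[ℝ]
    (PiLp 1 (fun _ : Fin d => ℝ) →L[ℝ] PiLp 1 (fun _ : Fin d => ℝ)) :=
  AlgHom.ofLinearMap
    { toFun := toL1CLM
      map_add' := fun A B => by
        ext x i
        simp [toL1CLM_apply, add_mul, Finset.sum_add_distrib]
      map_smul' := fun c A => by
        ext x i
        simp [toL1CLM_apply, mul_assoc, Finset.mul_sum] }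
    (by
      ext x i
      simp [toL1CLM_apply, Matrix.one_apply])
    (fun A B => by
      ext x i
      change ((A * B) *ᵥ x.ofLp) i = (A *ᵥ (B *ᵥ x.ofLp)) i
      rw [mulVec_mulVec])

theorem toL1CLMHom_apply (A : Matrix (Fin d) (Fin d) ℝ) : toL1CLMHom d A = A.toL1CLM :=
  rfl

open scoped Matrix.Norms.Operator in
theorem toL1CLM_exp (A : Matrix (Fin d) (Fin d) ℝ) :
    (NormedSpace.exp A).toL1CLM = NormedSpace.exp A.toL1CLM := by
  let _ : NormedAlgebra ℚ (PiLp 1 (fun _ : Fin d => ℝ) →L[ℝ] PiLp 1 (fun _ : Fin d => ℝ)) :=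
    NormedAlgebra.restrictScalars ℚ ℝ _
  let _ : NormedAlgebra ℚ (Matrix (Fin d) (Fin d) ℝ) := NormedAlgebra.restrictScalars ℚ ℝ _
  have : Continuous (toL1CLMHom d) := (toL1CLMHom d).toLinearMap.continuous_of_finiteDimensional
  exact NormedSpace.map_exp (toL1CLMHom d) this A

theorem abs_apply_le_l1OpNorm (A : Matrix (Fin d) (Fin d) ℝ) (i j : Fin d) :
    |A i j| ≤ A.l1OpNorm := by
  have h := A.toL1CLM.le_opNorm (PiLp.single 1 j (1 : ℝ))
  rw [PiLp.norm_single, norm_one, mul_one] at h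
  refine le_trans ?_ h
  refine le_trans (le_of_eq ?_) (PiLp.norm_apply_le _ i)
  simp [toL1CLM_apply]

theorem ColumnStochastic.l1OpNorm_le_one {A : Matrix (Fin d) (Fin d) ℝ}
    (hA : A.ColumnStochastic) : A.l1OpNorm ≤ 1 := by
  refine ContinuousLinearMap.opNorm_le_bound _ zero_le_one fun x => ?_
  rw [one_mul, PiLp.norm_eq_of_L1, PiLp.norm_eq_of_L1]
  calc ∑ i, ‖A.toL1CLM x i‖ ≤ ∑ i, ∑ j, A i j * ‖x j‖ := by
        refine Finset.sum_le_sum fun i _ => ?_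
        rw [toL1CLM_apply]
        refine (norm_sum_le _ _).trans (Finset.sum_le_sum fun j _ => ?_)
        rw [norm_mul, Real.norm_of_nonneg (hA.1 i j)]
    _ = ∑ j, ‖x j‖ := by
        rw [Finset.sum_comm]
        simp_rw [← Finset.sum_mul, hA.2, one_mul]

open scoped Matrix.Norms.Operator in
theorem hasDerivAt_exp_smul_zero (Q : Matrix (Fin d) (Fin d) ℝ) (i j : Fin d) :
    HasDerivAt (fun t : ℝ => NormedSpace.exp (t • Q) i j) (Q i j) 0 := by
  have h := hasDerivAt_exp_smul_const (𝕂 := ℝ) Q (0 : ℝ)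
  rw [zero_smul, NormedSpace.exp_zero, one_mul] at h
  exact hasDerivAt_pi.mp (hasDerivAt_pi.mp h i) j

theorem nonneg_of_exp_smul_columnStochastic {Q : Matrix (Fin d) (Fin d) ℝ}
    (hQ : ∀ t : ℝ, 0 ≤ t → (NormedSpace.exp (t • Q)).ColumnStochastic) {i j : Fin d}
    (hij : i ≠ j) : 0 ≤ Q i j := by
  have h := (hasDerivAt_exp_smul_zero Q i j).hasDerivWithinAt (s := Set.Ioi 0)
  rw [hasDerivWithinAt_iff_tendsto_slope' (by simp)] at h
  refine ge_of_tendsto h (eventually_nhdsWithin_of_forall fun t ht => ?_)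
  rw [slope_def_field, zero_smul, NormedSpace.exp_zero, one_apply_ne hij, sub_zero, sub_zero]
  exact div_nonneg ((hQ t (le_of_lt ht)).1 i j) (le_of_lt ht)

theorem sum_col_eq_zero_of_exp_smul_columnStochastic {Q : Matrix (Fin d) (Fin d) ℝ}
    (hQ : ∀ t : ℝ, 0 ≤ t → (NormedSpace.exp (t • Q)).ColumnStochastic) (j : Fin d) :
    ∑ i, Q i j = 0 := by
  have h := (HasDerivAt.fun_sum (u := Finset.univ)
    fun i _ => hasDerivAt_exp_smul_zero Q i j).hasDerivWithinAt (s := Set.Ici 0)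
  have h' : HasDerivWithinAt (fun t : ℝ => ∑ i, NormedSpace.exp (t • Q) i j) 0 (Set.Ici 0) 0 :=
    (hasDerivWithinAt_const 0 _ (1 : ℝ)).congr (fun t ht => (hQ t ht).2 j) ((hQ 0 le_rfl).2 j)
  exact (uniqueDiffOn_Ici (0 : ℝ) 0 Set.self_mem_Ici).eq_deriv _ h h'

theorem columnStochastic_one_add_inv_smul {Q : Matrix (Fin d) (Fin d) ℝ}
    (hQ : ∀ t : ℝ, 0 ≤ t → (NormedSpace.exp (t • Q)).ColumnStochastic) {c : ℝ} (hc : 0 < c)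
    (hdiag : ∀ i, |Q i i| ≤ c) : (1 + c⁻¹ • Q).ColumnStochastic := by
  refine ⟨fun i j => ?_, fun j => ?_⟩
  · rw [add_apply, smul_apply, smul_eq_mul]
    rcases eq_or_ne i j with rfl | hij
    · rw [one_apply_eq]
      have := mul_le_mul_of_nonneg_left (neg_le_of_abs_le (hdiag i)) (inv_pos.mpr hc).le
      rw [mul_neg, inv_mul_cancel₀ hc.ne'] at this
      linarith
    · rw [one_apply_ne hij, zero_add]
      exact mul_nonneg (inv_pos.mpr hc).le (nonneg_of_exp_smul_columnStochastic hQ hij)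
  · simp_rw [add_apply, smul_apply, smul_eq_mul, Finset.sum_add_distrib, ← Finset.mul_sum,
      sum_col_eq_zero_of_exp_smul_columnStochastic hQ, mul_zero, add_zero]
    simp [one_apply]

end Matrix

/-- **Decoupled Markov group conjecture (Kingman).**
For every `M ≥ 1` there is `C = C(M) ∈ [0,∞)`, independent of the dimension `d`, such
that every matrix `Q ∈ ℝ^{d×d}` with `‖e^{-Q}‖ ≤ M` whose semigroup `(e^{tQ})_{t ≥ 0}`
is column stochastic satisfies `‖Q‖ ≤ C` (operator norms induced by the `1`-norm). -/
theorem decoupled_markov_group_conjecture (M : ℝ) (hM : 1 ≤ M) :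
    ∃ C : ℝ, 0 ≤ C ∧
      ∀ (d : ℕ) (Q : Matrix (Fin d) (Fin d) ℝ),
        Matrix.l1OpNorm (NormedSpace.exp (-Q)) ≤ M →
        (∀ t : ℝ, 0 ≤ t → Matrix.ColumnStochastic (NormedSpace.exp (t • Q))) →
        Matrix.l1OpNorm Q ≤ C := by
  refine ⟨M ^ 2, sq_nonneg M, fun d Q hQM hQ => ?_⟩
  rcases (show 0 ≤ Q.l1OpNorm from norm_nonneg _).eq_or_lt with h0 | hc
  · rw [← h0]
    exact sq_nonneg M
  have hS : ‖1 + Q.l1OpNorm⁻¹ • Q.toL1CLM‖ ≤ 1 := by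
    have h := (Matrix.columnStochastic_one_add_inv_smul hQ hc
      fun i => Q.abs_apply_le_l1OpNorm i i).l1OpNorm_le_one
    rwa [Matrix.l1OpNorm, ← Matrix.toL1CLMHom_apply, map_add, map_one, map_smul] at h
  have h := norm_le_sqrt_mul_norm_exp_neg ContinuousLinearMap.norm_id_le hc hS
  rw [← Matrix.toL1CLMHom_apply, ← map_neg, Matrix.toL1CLMHom_apply, Matrix.toL1CLMHom_apply,
    ← Matrix.toL1CLM_exp] at h
  have hs : 0 < √Q.l1OpNorm := Real.sqrt_pos.mpr hc
  have hle : √Q.l1OpNorm * √Q.l1OpNorm ≤ √Q.l1OpNorm * M := by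
    rw [Real.mul_self_sqrt hc.le]
    exact h.trans (mul_le_mul_of_nonneg_left hQM hs.le)
  rw [← Real.sq_sqrt hc.le]
  exact pow_le_pow_left₀ hs.le (le_of_mul_le_mul_left hle hs) 2
end

section
/- Let d ∈ ℕ and let Q ∈ ℝ^{d×d} be a matrix such that the matrix exponential e^{tQ} is column stochastic for every t ∈ [0,∞) and such that ‖e^{-Q}‖ ≤ 1. Then Q = 0. -/
open scoped Matrix

/-- A matrix of `1`-operator norm at most one does not increase the `1`-norm of a vector. -/
theorem Matrix.sum_abs_mulVec_le_of_l1OpNorm_le_one {d : ℕ} {A : Matrix (Fin d) (Fin d) ℝ}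
    (hA : A.l1OpNorm ≤ 1) (x : Fin d → ℝ) : ∑ i, |(A *ᵥ x) i| ≤ ∑ i, |x i| := by
  have h := A.toL1CLM.le_of_opNorm_le hA (WithLp.toLp 1 x)
  rw [one_mul, PiLp.norm_eq_of_nat 1 (by norm_num), PiLp.norm_eq_of_nat 1 (by norm_num)] at h
  simpa [Matrix.toL1CLM] using h

/-- A column stochastic matrix does not increase the `1`-norm of a vector. -/
theorem Matrix.ColumnStochastic.sum_abs_mulVec_le {d : ℕ} {A : Matrix (Fin d) (Fin d) ℝ}
    (hA : A.ColumnStochastic) (x : Fin d → ℝ) : ∑ i, |(A *ᵥ x) i| ≤ ∑ i, |x i| :=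
  calc ∑ i, |(A *ᵥ x) i| ≤ ∑ i, ∑ j, A i j * |x j| := by
        refine Finset.sum_le_sum fun i _ =>
          (Finset.abs_sum_le_sum_abs (fun j => A i j * x j) Finset.univ).trans_eq ?_
        exact Finset.sum_congr rfl fun j _ => by rw [abs_mul, abs_of_nonneg (hA.1 i j)]
    _ = ∑ j, |x j| := by
        rw [Finset.sum_comm]
        simp [← Finset.sum_mul, hA.2]

/-- If a column stochastic matrix does not decrease `1`-norms, then distinct columns have disjoint
supports. -/
theorem Matrix.ColumnStochastic.eq_zero_or_eq_zero {d : ℕ} {A : Matrix (Fin d) (Fin d) ℝ}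
    (hA : A.ColumnStochastic) (h : ∀ x : Fin d → ℝ, ∑ i, |x i| ≤ ∑ i, |(A *ᵥ x) i|)
    {j k : Fin d} (hjk : j ≠ k) (i : Fin d) : A i j = 0 ∨ A i k = 0 := by
  have h2 : (2 : ℝ) ≤ ∑ i, |A i j - A i k| := by
    have hx : ∑ i, |(Pi.single j 1 - Pi.single k 1 : Fin d → ℝ) i| = 2 := by
      have : ∀ i, |(Pi.single j 1 - Pi.single k 1 : Fin d → ℝ) i| =
          (Pi.single j 1 : Fin d → ℝ) i + (Pi.single k 1 : Fin d → ℝ) i := by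
        intro i
        by_cases hj : i = j
        · subst hj; simp [hjk]
        · by_cases hk : i = k
          · subst hk; simp [hj]
          · simp [hj, hk]
      simp only [this, Finset.sum_add_distrib]
      simp [one_add_one_eq_two]
    have := h (Pi.single j 1 - Pi.single k 1)
    rw [hx] at this
    simpa [Matrix.mulVec_sub] using this
  have hterm : ∀ i ∈ Finset.univ, |A i j - A i k| ≤ A i j + A i k := fun i _ =>
    abs_le.2 ⟨by linarith [hA.1 i j], by linarith [hA.1 i k]⟩
  have hsum : ∑ i, (A i j + A i k) = 2 := by
    rw [Finset.sum_add_distrib, hA.2, hA.2]; norm_num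
  have heq := (Finset.sum_eq_sum_iff_of_le hterm).1
    (le_antisymm (Finset.sum_le_sum hterm) (hsum.trans_le h2)) i (Finset.mem_univ i)
  rcases abs_cases (A i j - A i k) with h' | h'
  · right; linarith [h'.1]
  · left; linarith [h'.1]

open scoped Matrix.Norms.Operator in
/-- The matrix semigroup `t ↦ exp (t • Q)` has derivative `Q` at `0`, entry by entry. -/
theorem Matrix.hasDerivAt_exp_smul_apply_zero {d : ℕ} (Q : Matrix (Fin d) (Fin d) ℝ)
    (i j : Fin d) :
    HasDerivAt (fun t : ℝ => NormedSpace.exp (t • Q) i j) (Q i j) 0 := by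
  have h := hasDerivAt_exp_smul_const (𝕂 := ℝ) Q (0 : ℝ)
  rw [zero_smul, NormedSpace.exp_zero, one_mul] at h
  exact ((Matrix.entryLinearMap ℝ ℝ i j).toContinuousLinearMap.hasFDerivAt.comp_hasDerivAt 0 h)

/-- If `Q ∈ ℝ^{d×d}` generates a column stochastic semigroup `(e^{tQ})_{t ≥ 0}` and
`‖e^{-Q}‖ ≤ 1` (operator norm induced by the `1`-norm), then `Q = 0`. -/
theorem eq_zero_of_column_stochastic_of_exp_neg_contractive {d : ℕ}
    (Q : Matrix (Fin d) (Fin d) ℝ)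
    (hstoch : ∀ t : ℝ, 0 ≤ t → Matrix.ColumnStochastic (NormedSpace.exp (t • Q)))
    (hle : Matrix.l1OpNorm (NormedSpace.exp (-Q)) ≤ 1) :
    Q = 0 := by
  have hexpand : ∀ t : ℝ, t ≤ 1 → ∀ x : Fin d → ℝ,
      ∑ i, |x i| ≤ ∑ i, |(NormedSpace.exp (t • Q) *ᵥ x) i| := by
    intro t ht1 x
    have hinv : NormedSpace.exp (-Q) *
        (NormedSpace.exp ((1 - t) • Q) * NormedSpace.exp (t • Q)) = 1 := by
      rw [← Matrix.exp_add_of_commute _ _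
        (((Commute.refl Q).smul_left (1 - t)).smul_right t), ← add_smul, sub_add_cancel, one_smul,
        ← Matrix.exp_add_of_commute _ _ (Commute.refl Q).neg_left, neg_add_cancel,
        NormedSpace.exp_zero]
    calc ∑ i, |x i|
        = ∑ i, |(NormedSpace.exp (-Q) *ᵥ (NormedSpace.exp ((1 - t) • Q) *ᵥ
            (NormedSpace.exp (t • Q) *ᵥ x))) i| := by
          rw [Matrix.mulVec_mulVec, Matrix.mulVec_mulVec, mul_assoc, hinv, Matrix.one_mulVec]
      _ ≤ _ := Matrix.sum_abs_mulVec_le_of_l1OpNorm_le_one hle _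
      _ ≤ _ := (hstoch (1 - t) (by linarith)).sum_abs_mulVec_le _
  have hdiag : ∀ᶠ t : ℝ in nhds 0, ∀ i, 0 < NormedSpace.exp (t • Q) i i := by
    refine Filter.eventually_all.2 fun i => ?_
    refine (Q.hasDerivAt_exp_smul_apply_zero i i).continuousAt.eventually_const_lt ?_
    simp [NormedSpace.exp_zero]
  have hone : ∀ᶠ t : ℝ in nhdsWithin 0 (Set.Ici 0),
      NormedSpace.exp (t • Q) = (1 : Matrix (Fin d) (Fin d) ℝ) := by
    filter_upwards [hdiag.filter_mono nhdsWithin_le_nhds, self_mem_nhdsWithin,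
      (eventually_le_nhds (zero_lt_one' ℝ)).filter_mono nhdsWithin_le_nhds] with t hd ht0 ht1
    have hoff : ∀ i j, i ≠ j → NormedSpace.exp (t • Q) i j = 0 := fun i j hij =>
      ((hstoch t ht0).eq_zero_or_eq_zero (hexpand t ht1) hij i).resolve_left (hd i).ne'
    ext i j
    by_cases hij : i = j
    · subst hij
      rw [Matrix.one_apply_eq, ← (hstoch t ht0).2 i]
      exact (Finset.sum_eq_single_of_mem i (Finset.mem_univ i) fun k _ hk => hoff k i hk).symm
    · rw [hoff i j hij, Matrix.one_apply_ne hij]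
  ext i j
  have hconst : HasDerivWithinAt (fun t : ℝ => NormedSpace.exp (t • Q) i j) 0 (Set.Ici 0) 0 :=
    (hasDerivWithinAt_const (0 : ℝ) (Set.Ici 0)
      ((1 : Matrix (Fin d) (Fin d) ℝ) i j)).congr_of_eventuallyEq_of_mem
      (hone.mono fun t ht =>
        congrArg (fun A : Matrix (Fin d) (Fin d) ℝ => A i j) ht) Set.self_mem_Ici
  exact (uniqueDiffOn_Ici (0 : ℝ) 0 Set.self_mem_Ici).eq_deriv _
    (Q.hasDerivAt_exp_smul_apply_zero i j).hasDerivWithinAt hconst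
end

section
/- Fix p ∈ [1,∞) with p ≠ 2 and a real number M ≥ 1. Then there exists a constant C = C(p, M) ∈ [0,∞), depending only on p and M, with the following property: for every measure space and every bounded linear operator Q on the real Banach space L^p over that measure space such that ‖e^{tQ}‖ ≤ 1 for every t ∈ [0,∞) (i.e., the semigroup generated by Q is contractive) and such that ‖e^{-Q}‖ ≤ M, one has ‖Q‖ ≤ C. -/
open MeasureTheory ENNReal

/-- The signed power `x ↦ |x| ^ (p - 1) * sgn x`. -/
noncomputable def signedPow (p x : ℝ) : ℝ := |x| ^ (p - 2) * x

/-- The complex duality function `z ↦ |z| ^ (p - 2) * conj z`. -/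
noncomputable def dualityFun (p : ℝ) (z : ℂ) : ℂ := (‖z‖ ^ (p - 2) : ℝ) * star z

/-- The map `r * exp (i α) ↦ r * exp (3 i α)`. -/
noncomputable def tripleArg (z : ℂ) : ℂ := z ^ 3 / (‖z‖ ^ 2 : ℝ)

lemma dualityFun_ofReal (p x : ℝ) : dualityFun p x = signedPow p x := by
  simp [dualityFun, signedPow]

lemma norm_dualityFun_le {p : ℝ} (z : ℂ) : ‖dualityFun p z‖ ≤ ‖z‖ ^ (p - 1) := by
  rcases eq_or_ne z 0 with rfl | hz
  · simpa [dualityFun] using Real.rpow_nonneg le_rfl (p - 1)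
  · have h : 0 < ‖z‖ := norm_pos_iff.2 hz
    rw [dualityFun, norm_mul, norm_star, Complex.norm_real, Real.norm_eq_abs,
      abs_of_nonneg (by positivity), ← Real.rpow_add_one h.ne']
    exact (congrArg _ (by ring)).le

lemma abs_signedPow_le {p : ℝ} (x : ℝ) : |signedPow p x| ≤ |x| ^ (p - 1) := by
  simpa [dualityFun_ofReal] using norm_dualityFun_le (p := p) (x : ℂ)

lemma signedPow_mul_self {p : ℝ} (hp : 1 ≤ p) (x : ℝ) : signedPow p x * x = |x| ^ p := by
  rcases eq_or_ne x 0 with rfl | hx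
  · simp [Real.zero_rpow (by linarith : p ≠ 0)]
  · have h : 0 < |x| := abs_pos.2 hx
    have h2 : |x| ^ p = |x| ^ (p - 2) * |x| ^ (2 : ℝ) := by
      rw [← Real.rpow_add h]; congr 1; ring
    rw [h2, Real.rpow_two, sq_abs, signedPow]
    ring

/-- `dualityFun p` is a subgradient of `‖·‖ ^ p / p`. -/
lemma norm_rpow_add_mul_re_le {p : ℝ} (hp : 1 ≤ p) (z w : ℂ) :
    ‖z‖ ^ p + p * (w * dualityFun p z).re ≤ ‖z + w‖ ^ p := by
  rcases eq_or_ne z 0 with rfl | hz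
  · simp [dualityFun, Real.zero_rpow (by linarith : p ≠ 0)]
    positivity
  have hr : 0 < ‖z‖ := norm_pos_iff.2 hz
  have h1 := one_add_mul_self_le_rpow_one_add (s := ‖z + w‖ / ‖z‖ - 1) (by
    have : 0 ≤ ‖z + w‖ / ‖z‖ := by positivity
    linarith) hp
  rw [add_sub_cancel, Real.div_rpow (by positivity) (by positivity), le_div_iff₀ (by positivity)]
    at h1
  refine le_trans ?_ h1
  have h2 : ((z + w) * star z).re ≤ ‖z + w‖ * ‖z‖ := by
    refine (Complex.re_le_norm _).trans ?_
    rw [norm_mul, norm_star]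
  have h3 : (z * star z).re = ‖z‖ ^ 2 := by
    simp [Complex.mul_conj, Complex.normSq_eq_norm_sq]
    norm_cast
  have h4 : (w * dualityFun p z).re = ‖z‖ ^ (p - 2) * (w * star z).re := by
    rw [dualityFun, mul_left_comm, Complex.re_ofReal_mul]
  have h5 : ‖z‖ ^ p = ‖z‖ ^ (p - 2) * ‖z‖ ^ 2 := by
    rw [← Real.rpow_two, ← Real.rpow_add hr]; congr 1; ring
  have h6 : (w * star z).re ≤ ‖z + w‖ * ‖z‖ - ‖z‖ ^ 2 := by
    rw [add_mul, Complex.add_re, h3] at h2; linarith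
  have h7 : (1 + p * (‖z + w‖ / ‖z‖ - 1)) * ‖z‖ ^ p
      = ‖z‖ ^ p + p * (‖z‖ ^ (p - 2) * (‖z + w‖ * ‖z‖ - ‖z‖ ^ 2)) := by
    rw [h5]; field_simp
  rw [h7, h4]
  gcongr

lemma abs_rpow_add_mul_le {p : ℝ} (hp : 1 ≤ p) (x y : ℝ) :
    |x| ^ p + p * (y * signedPow p x) ≤ |x + y| ^ p := by
  have h := norm_rpow_add_mul_re_le hp (x : ℂ) (y : ℂ)
  rw [dualityFun_ofReal] at h
  simpa [← Complex.ofReal_mul, ← Complex.ofReal_add] using h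

lemma measurable_signedPow (p : ℝ) : Measurable (signedPow p) := by
  unfold signedPow; fun_prop

lemma measurable_dualityFun (p : ℝ) : Measurable (dualityFun p) := by
  unfold dualityFun
  have : Measurable (star : ℂ → ℂ) := continuous_star.measurable
  fun_prop

lemma measurable_tripleArg : Measurable tripleArg := by
  unfold tripleArg; fun_prop

lemma norm_tripleArg (z : ℂ) : ‖tripleArg z‖ = ‖z‖ := by
  rcases eq_or_ne z 0 with rfl | hz
  · simp [tripleArg]
  · have : ‖z‖ ≠ 0 := norm_ne_zero_iff.2 hz
    simp only [tripleArg, norm_div, norm_pow, Complex.norm_real, norm_norm]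
    field_simp

lemma tripleArg_mul_exp {r : ℝ} (hr : 0 < r) (a : ℝ) :
    tripleArg (r * Complex.exp (a * Complex.I)) = r * Complex.exp (3 * a * Complex.I) := by
  have h : Complex.exp (3 * a * Complex.I) = Complex.exp (a * Complex.I) ^ 3 := by
    rw [← Complex.exp_nat_mul]; push_cast; ring_nf
  have hr' : (r : ℂ) ≠ 0 := by exact_mod_cast hr.ne'
  rw [tripleArg, norm_mul, Complex.norm_exp_ofReal_mul_I, h]
  simp only [Complex.norm_real, mul_one, Real.norm_eq_abs, sq_abs]
  push_cast
  field_simp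

/-- The circle function `Re (exp (i θ) z + c exp (3 i θ) w)`. -/
noncomputable def circleRe (c z w : ℂ) (θ : ℝ) : ℝ :=
  (Complex.exp (θ * Complex.I) * z + c * Complex.exp (3 * θ * Complex.I) * w).re

/-- Fourier coefficients of the signed power of `Re (exp (i θ) + c exp (3 i θ))`. -/
noncomputable def circleCoeff (p : ℝ) (m : ℕ) (c : ℂ) : ℂ :=
  ∫ θ in (0 : ℝ)..(2 * Real.pi),
    Complex.exp (m * θ * Complex.I) * signedPow p (circleRe c 1 1 θ)

lemma exp_periodic (m : ℕ) (θ : ℝ) :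
    Complex.exp (m * (θ + 2 * Real.pi : ℝ) * Complex.I) = Complex.exp (m * θ * Complex.I) := by
  have h : (m * (θ + 2 * Real.pi : ℝ) * Complex.I : ℂ)
      = m * θ * Complex.I + m * (2 * Real.pi * Complex.I) := by
    push_cast; ring
  rw [h, Complex.exp_add, Complex.exp_nat_mul_two_pi_mul_I, mul_one]

lemma circleRe_periodic (c z w : ℂ) : Function.Periodic (circleRe c z w) (2 * Real.pi) := by
  intro θ
  have h1 := exp_periodic 1 θ
  have h3 := exp_periodic 3 θ
  simp only [Nat.cast_one, one_mul, Nat.cast_ofNat] at h1 h3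
  simp only [circleRe, h1, h3]

lemma circleRe_polar (c : ℂ) (r a θ : ℝ) :
    circleRe c (r * Complex.exp (a * Complex.I)) (r * Complex.exp (3 * a * Complex.I)) θ
      = r * circleRe c 1 1 (θ + a) := by
  rw [circleRe, circleRe, ← Complex.re_ofReal_mul]
  congr 1
  push_cast
  rw [mul_one, mul_one, add_mul, mul_add, mul_add 3, add_mul, Complex.exp_add, Complex.exp_add]
  ring

lemma signedPow_mul {p r : ℝ} (hr : 0 ≤ r) (x : ℝ) :
    signedPow p (r * x) = r ^ (p - 2) * r * signedPow p x := by
  rw [signedPow, signedPow, abs_mul, abs_of_nonneg hr, Real.mul_rpow hr (abs_nonneg x)]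
  ring

lemma dualityFun_polar {p r : ℝ} (hr : 0 ≤ r) (a : ℝ) :
    dualityFun p (r * Complex.exp (a * Complex.I))
      = (r ^ (p - 2) * r : ℝ) * Complex.exp (-(a * Complex.I)) := by
  rw [dualityFun, norm_mul, Complex.norm_exp_ofReal_mul_I, Complex.norm_real, mul_one,
    Real.norm_eq_abs, abs_of_nonneg hr]
  have : star (Complex.exp (a * Complex.I)) = Complex.exp (-(a * Complex.I)) := by
    rw [Complex.star_def, ← Complex.exp_conj]; simp
  rw [star_mul, this, Complex.star_def, Complex.conj_ofReal]
  push_cast; ring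

lemma integral_exp_mul_signedPow_polar {p r : ℝ} (hr : 0 < r) (a : ℝ) (m : ℕ) (c : ℂ) :
    ∫ θ in (0 : ℝ)..(2 * Real.pi), Complex.exp (m * θ * Complex.I) * signedPow p
        (circleRe c (r * Complex.exp (a * Complex.I)) (r * Complex.exp (3 * a * Complex.I)) θ)
      = dualityFun p (r * Complex.exp ((m * a : ℝ) * Complex.I)) * circleCoeff p m c := by
  set g : ℝ → ℂ := fun θ ↦ Complex.exp (m * θ * Complex.I) * signedPow p (circleRe c 1 1 θ)
    with hg
  have hper : Function.Periodic g (2 * Real.pi) := by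
    intro θ
    simp only [hg, exp_periodic, circleRe_periodic c 1 1 θ]
  have h1 : ∫ θ in (0 : ℝ)..(2 * Real.pi), g (θ + a) = circleCoeff p m c := by
    rw [intervalIntegral.integral_comp_add_right, add_comm (2 * Real.pi), zero_add,
      hper.intervalIntegral_add_eq a 0, zero_add, circleCoeff]
  rw [dualityFun_polar hr.le, ← h1, ← intervalIntegral.integral_const_mul]
  congr 1
  ext θ
  rw [circleRe_polar, signedPow_mul hr.le, hg]
  have : Complex.exp (m * (θ + a : ℝ) * Complex.I)
      = Complex.exp (m * θ * Complex.I) * Complex.exp ((m * a : ℝ) * Complex.I) := by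
    rw [← Complex.exp_add]; push_cast; ring_nf
  simp only [this, Complex.exp_neg]
  have := Complex.exp_ne_zero ((m * a : ℝ) * Complex.I)
  field_simp
  push_cast
  ring

lemma integral_exp_one_mul_signedPow (p : ℝ) (c z : ℂ) :
    ∫ θ in (0 : ℝ)..(2 * Real.pi), Complex.exp (θ * Complex.I) * signedPow p
        (circleRe c z (tripleArg z) θ) = dualityFun p z * circleCoeff p 1 c := by
  rcases eq_or_ne z 0 with rfl | hz
  · simp [tripleArg, circleRe, signedPow, dualityFun]
  have hr : 0 < ‖z‖ := norm_pos_iff.2 hz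
  have h := integral_exp_mul_signedPow_polar (p := p) hr z.arg 1 c
  rw [← tripleArg_mul_exp hr] at h
  simpa using h

lemma integral_exp_three_mul_signedPow (p : ℝ) (c z : ℂ) :
    ∫ θ in (0 : ℝ)..(2 * Real.pi), Complex.exp (3 * θ * Complex.I) * signedPow p
        (circleRe c z (tripleArg z) θ) = dualityFun p (tripleArg z) * circleCoeff p 3 c := by
  rcases eq_or_ne z 0 with rfl | hz
  · simp [tripleArg, circleRe, signedPow, dualityFun]
  have hr : 0 < ‖z‖ := norm_pos_iff.2 hz
  have h := integral_exp_mul_signedPow_polar (p := p) hr z.arg 3 c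
  have h2 := tripleArg_mul_exp hr z.arg
  push_cast at h
  rw [← h2] at h
  simpa using h

lemma continuous_circleRe (c z w : ℂ) : Continuous (circleRe c z w) := by
  unfold circleRe; fun_prop

lemma intervalIntegrable_signedPow_circleRe {p : ℝ} (hp : 1 ≤ p) (c : ℂ) (a b : ℝ) :
    IntervalIntegrable (fun θ ↦ signedPow p (circleRe c 1 1 θ)) volume a b := by
  have hc : Continuous fun θ ↦ |circleRe c 1 1 θ| ^ (p - 1) :=
    ((continuous_circleRe c 1 1).abs).rpow_const fun _ ↦ Or.inr (by linarith)
  refine (hc.intervalIntegrable a b).mono_fun'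
    ((measurable_signedPow p).comp (continuous_circleRe c 1 1).measurable).aestronglyMeasurable ?_
  exact Filter.Eventually.of_forall fun θ ↦ abs_signedPow_le _

lemma intervalIntegrable_mul_signedPow {p : ℝ} (hp : 1 ≤ p) (c : ℂ) (a b : ℝ) {f : ℝ → ℂ}
    (hf : Continuous f) :
    IntervalIntegrable (fun θ ↦ f θ * signedPow p (circleRe c 1 1 θ)) volume a b :=
  have h := intervalIntegrable_signedPow_circleRe hp c a b
  IntervalIntegrable.continuousOn_mul (f := fun θ ↦ (signedPow p (circleRe c 1 1 θ) : ℂ))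
    ⟨h.1.ofReal, h.2.ofReal⟩ hf.continuousOn

lemma intervalIntegral_re {f : ℝ → ℂ} {a b : ℝ} (hf : IntervalIntegrable f volume a b) :
    (∫ θ in a..b, f θ).re = ∫ θ in a..b, (f θ).re :=
  (Complex.reCLM.intervalIntegral_comp_comm hf).symm

lemma re_shift_circleCoeff_nonpos {p : ℝ} (hp : 1 ≤ p) (c : ℂ) (t : ℝ) :
    ((Complex.exp (t * Complex.I) - 1) * circleCoeff p 1 c
      + c * (Complex.exp (3 * t * Complex.I) - 1) * circleCoeff p 3 c).re ≤ 0 := by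
  set v := circleRe c 1 1 with hv
  have hvc : Continuous v := continuous_circleRe c 1 1
  have hp0 : 0 < p := by linarith
  have hpow : Continuous fun θ ↦ |v θ| ^ p := hvc.abs.rpow_const fun _ ↦ Or.inr hp0.le
  have hper : Function.Periodic (fun θ ↦ |v θ| ^ p) (2 * Real.pi) := by
    intro θ; simp only [hv, circleRe_periodic c 1 1 θ]
  have hshift : ∫ θ in (0 : ℝ)..(2 * Real.pi), |v (θ + t)| ^ p
      = ∫ θ in (0 : ℝ)..(2 * Real.pi), |v θ| ^ p := by
    rw [intervalIntegral.integral_comp_add_right (fun θ ↦ |v θ| ^ p), add_comm (2 * Real.pi),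
      zero_add, hper.intervalIntegral_add_eq t 0, zero_add]
  have hsP := intervalIntegrable_signedPow_circleRe hp c 0 (2 * Real.pi)
  have hvt : Continuous fun θ ↦ v (θ + t) := by fun_prop
  have h_int : IntervalIntegrable (fun θ ↦ (v (θ + t) - v θ) * signedPow p (v θ)) volume 0
      (2 * Real.pi) := hsP.continuousOn_mul (hvt.sub hvc).continuousOn
  have hmono : ∫ θ in (0 : ℝ)..(2 * Real.pi),
        (|v θ| ^ p + p * ((v (θ + t) - v θ) * signedPow p (v θ)))
      ≤ ∫ θ in (0 : ℝ)..(2 * Real.pi), |v (θ + t)| ^ p := by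
    refine intervalIntegral.integral_mono_on (by positivity)
      ((hpow.intervalIntegrable _ _).add (h_int.const_mul p))
      (Continuous.intervalIntegrable (hpow.comp (continuous_add_const t)) _ _) fun θ _ ↦ ?_
    simpa using abs_rpow_add_mul_le hp (v θ) (v (θ + t) - v θ)
  rw [intervalIntegral.integral_add (hpow.intervalIntegrable _ _) (h_int.const_mul p),
    intervalIntegral.integral_const_mul, hshift] at hmono
  have hle : ∫ θ in (0 : ℝ)..(2 * Real.pi), (v (θ + t) - v θ) * signedPow p (v θ) ≤ 0 := by
    nlinarith
  refine le_of_eq_of_le ?_ hle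
  have h1 := intervalIntegrable_mul_signedPow hp c 0 (2 * Real.pi)
    (f := fun θ : ℝ ↦ Complex.exp ((1 : ℕ) * θ * Complex.I)) (by fun_prop)
  have h3 := intervalIntegrable_mul_signedPow hp c 0 (2 * Real.pi)
    (f := fun θ : ℝ ↦ Complex.exp ((3 : ℕ) * θ * Complex.I)) (by fun_prop)
  rw [circleCoeff, circleCoeff, ← intervalIntegral.integral_const_mul,
    ← intervalIntegral.integral_const_mul, ← intervalIntegral.integral_add (h1.const_mul _)
      (h3.const_mul _), intervalIntegral_re ((h1.const_mul _).add (h3.const_mul _))]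
  congr 1
  ext θ
  rw [← mul_assoc, ← mul_assoc, ← add_mul, Complex.re_mul_ofReal]
  congr 1
  rw [hv, circleRe, circleRe, ← Complex.sub_re]
  congr 1
  push_cast
  rw [mul_add, add_mul, add_mul, Complex.exp_add, Complex.exp_add]
  ring_nf

lemma re_I_mul_circleCoeff {p : ℝ} (hp : 1 ≤ p) (c : ℂ) :
    (Complex.I * circleCoeff p 1 c + 3 * Complex.I * c * circleCoeff p 3 c).re = 0 := by
  set k₁ := circleCoeff p 1 c
  set k₃ := circleCoeff p 3 c
  set G : ℝ → ℂ := fun t ↦ (Complex.exp (t * Complex.I) - 1) * k₁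
      + c * (Complex.exp (3 * t * Complex.I) - 1) * k₃ with hG
  have hd : HasDerivAt G (Complex.I * k₁ + 3 * Complex.I * c * k₃) 0 := by
    have h0 : HasDerivAt (fun t : ℝ ↦ (t : ℂ)) 1 0 := Complex.ofRealCLM.hasDerivAt
    have h1 : HasDerivAt (fun t : ℝ ↦ (t : ℂ) * Complex.I) (1 * Complex.I) 0 := h0.mul_const _
    have h3 : HasDerivAt (fun t : ℝ ↦ 3 * (t : ℂ) * Complex.I) (3 * 1 * Complex.I) 0 :=
      (h0.const_mul 3).mul_const _
    have := ((h1.cexp.sub_const 1).mul_const k₁).add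
      (((h3.cexp.sub_const 1).const_mul c).mul_const k₃)
    refine HasDerivAt.congr_deriv this ?_
    simp only [Complex.ofReal_zero, zero_mul, mul_zero, Complex.exp_zero]
    ring
  have hre : HasDerivAt (fun t ↦ (G t).re) (Complex.I * k₁ + 3 * Complex.I * c * k₃).re 0 :=
    Complex.reCLM.hasFDerivAt.comp_hasDerivAt (0 : ℝ) hd
  refine IsLocalMax.hasDerivAt_eq_zero (Filter.Eventually.of_forall fun t ↦ ?_) hre
  have : (G 0).re = 0 := by simp [hG]
  rw [this]
  exact re_shift_circleCoeff_nonpos hp c t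

lemma circleRe_zero (θ : ℝ) : circleRe 0 1 1 θ = Real.cos θ := by
  simp [circleRe, Complex.exp_ofReal_mul_I_re]

lemma integral_abs_cos_rpow_pos {p : ℝ} (hp : 1 ≤ p) :
    0 < ∫ θ in (0 : ℝ)..(2 * Real.pi), |Real.cos θ| ^ p := by
  have hc : Continuous fun θ ↦ |Real.cos θ| ^ p :=
    Real.continuous_cos.abs.rpow_const fun _ ↦ Or.inr (by linarith)
  refine intervalIntegral.integral_pos (by positivity) hc.continuousOn
    (fun _ _ ↦ by positivity) ⟨0, ⟨le_rfl, by positivity⟩, by simp⟩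

lemma re_circleCoeff_one_zero {p : ℝ} (hp : 1 ≤ p) :
    (circleCoeff p 1 0).re = ∫ θ in (0 : ℝ)..(2 * Real.pi), |Real.cos θ| ^ p := by
  rw [circleCoeff, intervalIntegral_re
    (intervalIntegrable_mul_signedPow hp 0 _ _ (by fun_prop))]
  congr 1
  ext θ
  rw [circleRe_zero, Complex.re_mul_ofReal]
  rw [Nat.cast_one, one_mul, Complex.exp_ofReal_mul_I_re, mul_comm, signedPow_mul_self hp]

lemma hasDerivAt_mul_abs_rpow {p : ℝ} (hp : 1 ≤ p) (x : ℝ) :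
    HasDerivAt (fun x : ℝ ↦ x * |x| ^ p) ((p + 1) * |x| ^ p) x := by
  rcases eq_or_ne x 0 with rfl | hx
  · rw [hasDerivAt_iff_tendsto_slope]
    have h0 : (p + 1) * |(0 : ℝ)| ^ p = |(0 : ℝ)| ^ p := by
      simp [Real.zero_rpow (by linarith : p ≠ 0)]
    have hc : Continuous fun x : ℝ ↦ |x| ^ p :=
      continuous_abs.rpow_const fun _ ↦ Or.inr (by linarith)
    rw [h0]
    refine (hc.continuousAt.mono_left nhdsWithin_le_nhds).congr' ?_
    filter_upwards [self_mem_nhdsWithin] with y hy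
    have hy : y ≠ 0 := hy
    rw [slope_def_field]
    field_simp
    simp
  · have h := (hasDerivAt_id x).mul ((hasDerivAt_abs hx).rpow_const (p := p)
      (Or.inl (abs_ne_zero.2 hx)))
    refine HasDerivAt.congr_deriv h ?_
    have h1 : |x| ^ p = |x| ^ (p - 1) * |x| := by
      rw [← Real.rpow_add_one (abs_ne_zero.2 hx)]; congr 1; ring
    have h2 : x * (SignType.sign x : ℝ) = |x| := self_mul_sign x
    simp only [id, one_mul]
    rw [h1, ← h2]
    ring

lemma integral_abs_cos_rpow_mul_sq {p : ℝ} (hp : 1 ≤ p) :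
    (p + 2) * ∫ θ in (0 : ℝ)..(2 * Real.pi), |Real.cos θ| ^ p * Real.cos θ ^ 2
      = (p + 1) * ∫ θ in (0 : ℝ)..(2 * Real.pi), |Real.cos θ| ^ p := by
  have hc : Continuous fun θ ↦ |Real.cos θ| ^ p :=
    Real.continuous_cos.abs.rpow_const fun _ ↦ Or.inr (by linarith)
  have hc2 : Continuous fun θ ↦ |Real.cos θ| ^ p * Real.cos θ ^ 2 := by fun_prop
  have hd : ∀ θ, HasDerivAt (fun θ ↦ Real.sin θ * (Real.cos θ * |Real.cos θ| ^ p))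
      ((p + 2) * (|Real.cos θ| ^ p * Real.cos θ ^ 2) - (p + 1) * |Real.cos θ| ^ p) θ := by
    intro θ
    have h := (Real.hasDerivAt_sin θ).mul
      ((hasDerivAt_mul_abs_rpow hp (Real.cos θ)).comp θ (Real.hasDerivAt_cos θ))
    refine HasDerivAt.congr_deriv h ?_
    simp only [Function.comp]
    linear_combination (-(p + 1) * |Real.cos θ| ^ p) * Real.sin_sq_add_cos_sq θ
  have h := intervalIntegral.integral_eq_sub_of_hasDerivAt (a := 0) (b := 2 * Real.pi)
    (fun θ _ ↦ hd θ) (Continuous.intervalIntegrable (by fun_prop) _ _)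
  rw [intervalIntegral.integral_sub (Continuous.intervalIntegrable (by fun_prop) _ _)
    (Continuous.intervalIntegrable (by fun_prop) _ _), intervalIntegral.integral_const_mul,
    intervalIntegral.integral_const_mul] at h
  simp at h
  linarith

lemma circleCoeff_three_zero_ne_zero {p : ℝ} (hp : 1 ≤ p) (hp2 : p ≠ 2) :
    circleCoeff p 3 0 ≠ 0 := by
  have hre : (circleCoeff p 3 0).re
      = 4 * (∫ θ in (0 : ℝ)..(2 * Real.pi), |Real.cos θ| ^ p * Real.cos θ ^ 2)
        - 3 * ∫ θ in (0 : ℝ)..(2 * Real.pi), |Real.cos θ| ^ p := by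
    have hc : Continuous fun θ ↦ |Real.cos θ| ^ p :=
      Real.continuous_cos.abs.rpow_const fun _ ↦ Or.inr (by linarith)
    rw [circleCoeff, intervalIntegral_re
      (intervalIntegrable_mul_signedPow hp 0 _ _ (by fun_prop)),
      ← intervalIntegral.integral_const_mul, ← intervalIntegral.integral_const_mul,
      ← intervalIntegral.integral_sub (Continuous.intervalIntegrable (by fun_prop) _ _)
        (Continuous.intervalIntegrable (by fun_prop) _ _)]
    congr 1
    ext θ
    have h3 : (Complex.exp ((3 : ℕ) * θ * Complex.I)).re = Real.cos (3 * θ) := by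
      rw [← Complex.exp_ofReal_mul_I_re]; push_cast; rfl
    rw [circleRe_zero, Complex.re_mul_ofReal, h3, Real.cos_three_mul, ← signedPow_mul_self hp]
    ring
  intro h0
  have h := integral_abs_cos_rpow_mul_sq hp
  have hpos := integral_abs_cos_rpow_pos hp
  rw [h0, Complex.zero_re] at hre
  set X := ∫ θ in (0 : ℝ)..(2 * Real.pi), |Real.cos θ| ^ p
  have : (p - 2) * X = 0 := by linear_combination -4 * h - (p + 2) * hre
  rcases mul_eq_zero.1 this with h | h
  · exact hp2 (by linarith)
  · linarith

lemma abs_circleRe_le {c : ℂ} (hc : ‖c‖ ≤ 1) (θ : ℝ) : |circleRe c 1 1 θ| ≤ 2 := by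
  refine (Complex.abs_re_le_norm _).trans ((norm_add_le _ _).trans ?_)
  have h3 : ‖Complex.exp (3 * θ * Complex.I)‖ = 1 := by
    have := Complex.norm_exp_ofReal_mul_I (3 * θ)
    push_cast at this; exact this
  rw [mul_one, mul_one, norm_mul, Complex.norm_exp_ofReal_mul_I, h3]
  linarith

lemma norm_exp_mul_signedPow_le {p : ℝ} (hp : 1 ≤ p) {c : ℂ} (hc : ‖c‖ ≤ 1) (m : ℕ) (θ : ℝ) :
    ‖Complex.exp (m * θ * Complex.I) * signedPow p (circleRe c 1 1 θ)‖ ≤ 2 ^ (p - 1) := by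
  have h : ‖Complex.exp (m * θ * Complex.I)‖ = 1 := by
    have := Complex.norm_exp_ofReal_mul_I (m * θ)
    push_cast at this; exact this
  rw [norm_mul, h, one_mul, Complex.norm_real]
  exact (abs_signedPow_le _).trans (Real.rpow_le_rpow (abs_nonneg _) (abs_circleRe_le hc θ)
    (by linarith))

lemma norm_circleCoeff_le {p : ℝ} (hp : 1 ≤ p) {c : ℂ} (hc : ‖c‖ ≤ 1) (m : ℕ) :
    ‖circleCoeff p m c‖ ≤ 2 ^ (p - 1) * |2 * Real.pi - 0| :=
  intervalIntegral.norm_integral_le_of_norm_le_const fun θ _ ↦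
    norm_exp_mul_signedPow_le hp hc m θ

lemma ae_cos_ne_zero : ∀ᵐ θ : ℝ, Real.cos θ ≠ 0 := by
  have : {θ : ℝ | Real.cos θ = 0}.Countable := by
    refine (Set.countable_range fun k : ℤ ↦ (2 * k + 1) * Real.pi / 2).mono fun θ hθ ↦ ?_
    obtain ⟨k, hk⟩ := Real.cos_eq_zero_iff.1 hθ
    exact ⟨k, hk.symm⟩
  simpa [ae_iff] using this.measure_zero volume

lemma continuousAt_circleCoeff {p : ℝ} (hp : 1 ≤ p) (m : ℕ) :
    ContinuousAt (circleCoeff p m) 0 := by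
  refine intervalIntegral.continuousAt_of_dominated_interval
    (bound := fun _ ↦ (2 : ℝ) ^ (p - 1)) ?_ ?_ (by simp) ?_
  · refine Filter.Eventually.of_forall fun c ↦ ?_
    exact (intervalIntegrable_mul_signedPow hp c 0 (2 * Real.pi)
      (f := fun θ : ℝ ↦ Complex.exp (m * θ * Complex.I)) (by fun_prop)).def'.aestronglyMeasurable
  · filter_upwards [Metric.ball_mem_nhds (0 : ℂ) one_pos] with c hc
    exact Filter.Eventually.of_forall fun θ _ ↦
      norm_exp_mul_signedPow_le hp (by simpa using (mem_ball_zero_iff.1 hc).le) m θ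
  · filter_upwards [ae_cos_ne_zero] with θ hθ _
    have h1 : ContinuousAt (fun c ↦ circleRe c 1 1 θ) 0 := by
      unfold circleRe; fun_prop
    have h2 : ContinuousAt (fun c ↦ signedPow p (circleRe c 1 1 θ)) 0 := by
      unfold signedPow
      exact (h1.abs.rpow_const (Or.inl (by simpa [circleRe_zero] using hθ))).mul h1
    exact continuousAt_const.mul (Complex.continuous_ofReal.continuousAt.comp h2)

lemma exists_norm_sub_le_of_re_circleCoeff_nonpos {p : ℝ} (hp : 1 ≤ p) (hp2 : p ≠ 2) :
    ∃ C : ℝ, 0 ≤ C ∧ ∀ a b : ℂ,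
      (∀ c, (circleCoeff p 1 c * a + c * circleCoeff p 3 c * b).re ≤ 0) →
        a.re ≤ 0 ∧ ‖b - 3 * a.im * Complex.I‖ ≤ C * -a.re := by
  set κ := circleCoeff p 3 0 with hκ
  have hκ0 : 0 < ‖κ‖ := norm_pos_iff.2 (circleCoeff_three_zero_ne_zero hp hp2)
  obtain ⟨ε, hε, hball⟩ := Metric.continuousAt_iff.1 (continuousAt_circleCoeff hp 3) (‖κ‖ / 2)
    (by positivity)
  obtain ⟨s, hs0, hs⟩ : ∃ s : ℝ, 0 < s ∧ s < min ε 1 := exists_between (by positivity)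
  set K := (2 : ℝ) ^ (p - 1) * |2 * Real.pi - 0| with hK
  have hKn : 0 ≤ K := by positivity
  refine ⟨K / (s * (‖κ‖ / 2)), by positivity, fun a b h ↦ ?_⟩
  have hpos := integral_abs_cos_rpow_pos hp
  rw [← re_circleCoeff_one_zero hp] at hpos
  have hsplit : ∀ c, (circleCoeff p 1 c * a + c * circleCoeff p 3 c * b).re
      = a.re * (circleCoeff p 1 c).re
        + (c * circleCoeff p 3 c * (b - 3 * a.im * Complex.I)).re := by
    intro c
    have h0 := re_I_mul_circleCoeff hp c
    have h1 : circleCoeff p 1 c * a + c * circleCoeff p 3 c * b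
        = a.re * circleCoeff p 1 c + c * circleCoeff p 3 c * (b - 3 * a.im * Complex.I)
          + a.im * (Complex.I * circleCoeff p 1 c + 3 * Complex.I * c * circleCoeff p 3 c) := by
      linear_combination -circleCoeff p 1 c * (Complex.re_add_im a)
    rw [h1, Complex.add_re, Complex.add_re, Complex.re_ofReal_mul, Complex.re_ofReal_mul, h0]
    ring
  have ha : a.re ≤ 0 := by
    have := h 0
    rw [hsplit 0] at this
    simp only [zero_mul, Complex.zero_re, add_zero] at this
    by_contra! hcon
    nlinarith
  refine ⟨ha, ?_⟩
  set d := b - 3 * a.im * Complex.I with hd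
  rcases eq_or_ne d 0 with hd0 | hd0
  · rw [hd0, norm_zero]
    have : 0 ≤ -a.re := by linarith
    positivity
  have hdn : 0 < ‖d‖ := norm_pos_iff.2 hd0
  set c : ℂ := s * (star (κ * d) / (‖κ * d‖ : ℝ)) with hc
  have hn0 : (‖κ * d‖ : ℂ) ≠ 0 := by
    rw [norm_mul]; exact_mod_cast (mul_pos hκ0 hdn).ne'
  have hcn : ‖c‖ = s := by
    have : ‖κ * d‖ ≠ 0 := by rw [norm_mul]; positivity
    rw [hc, norm_mul, norm_div, norm_star, Complex.norm_real, Complex.norm_real, norm_norm,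
      div_self this, mul_one, Real.norm_eq_abs, abs_of_pos hs0]
  have hmain : c * κ * d = (s * (‖κ‖ * ‖d‖) : ℝ) := by
    have : star (κ * d) * (κ * d) = (‖κ * d‖ : ℂ) ^ 2 := by
      rw [Complex.star_def, ← Complex.normSq_eq_conj_mul_self, Complex.normSq_eq_norm_sq]
      push_cast; rfl
    have h1 : c * κ * d = s * (star (κ * d) * (κ * d)) / ‖κ * d‖ := by rw [hc]; ring
    rw [h1, this, ← norm_mul]
    push_cast
    field_simp
  have hclose : ‖circleCoeff p 3 c - κ‖ ≤ ‖κ‖ / 2 := by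
    have := @hball c (by rw [dist_zero_right, hcn]; exact hs.trans_le (min_le_left _ _))
    rw [dist_eq_norm] at this
    exact this.le
  have hcc := h c
  rw [hsplit c] at hcc
  have hre : s * (‖κ‖ * ‖d‖) - s * (‖κ‖ / 2) * ‖d‖ ≤ (c * circleCoeff p 3 c * d).re := by
    have h1 : c * circleCoeff p 3 c * d = c * κ * d + c * (circleCoeff p 3 c - κ) * d := by ring
    rw [h1, Complex.add_re, hmain, Complex.ofReal_re]
    have h2 : ‖c * (circleCoeff p 3 c - κ) * d‖ ≤ s * (‖κ‖ / 2) * ‖d‖ := by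
      rw [norm_mul, norm_mul, hcn]; gcongr
    have h3 := (abs_le.1 (Complex.abs_re_le_norm (c * (circleCoeff p 3 c - κ) * d))).1
    linarith
  have hk1 : (circleCoeff p 1 c).re ≤ K :=
    (Complex.re_le_norm _).trans (norm_circleCoeff_le hp
      (by rw [hcn]; exact (hs.trans_le (min_le_right _ _)).le) 1)
  have hneg : -(a.re * (circleCoeff p 1 c).re) ≤ K * -a.re := by nlinarith
  rw [div_mul_eq_mul_div, le_div_iff₀ (by positivity)]
  linarith

section ExponentialGrowth

variable {𝔸 : Type*} [NormedRing 𝔸] [NormedAlgebra ℝ 𝔸] [CompleteSpace 𝔸]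

open Filter Topology in
lemma eventually_norm_exp_smul_sub_le (B : 𝔸) {ε : ℝ} (hε : 0 < ε) :
    ∀ᶠ r : ℝ in 𝓝[>] 0, ‖NormedSpace.exp (r • B) - (1 + r • B)‖ ≤ ε * r := by
  have h := (hasDerivAt_exp_smul_const (𝕂 := ℝ) B (0 : ℝ)).isLittleO
  have h2 := (h.bound hε).filter_mono (nhdsWithin_le_nhds (s := Set.Ioi (0 : ℝ)))
  filter_upwards [h2, self_mem_nhdsWithin] with r hr hr0
  have hr0 : 0 < r := hr0
  simpa [NormedSpace.exp_zero, sub_sub, abs_of_pos hr0] using hr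

open Filter Topology in
/-- First order growth bounds on `1 + r B` integrate to exponential bounds on `exp (t B)`. -/
lemma norm_exp_smul_le_of_eventually {B : 𝔸} {ω : ℝ}
    (h : ∀ ε > 0, ∀ᶠ r : ℝ in 𝓝[>] 0, ‖1 + r • B‖ ≤ 1 + (ω + ε) * r) {t : ℝ} (ht : 0 < t) :
    ‖NormedSpace.exp (t • B)‖ ≤ Real.exp (ω * t) := by
  have key : ∀ ε > 0, ‖NormedSpace.exp (t • B)‖ ≤ Real.exp ((ω + (ε + ε)) * t) := by
    intro ε hε
    have hev : ∀ᶠ r : ℝ in 𝓝[>] 0,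
        ‖NormedSpace.exp (r • B)‖ ≤ Real.exp ((ω + (ε + ε)) * r) := by
      filter_upwards [h ε hε, eventually_norm_exp_smul_sub_le B hε] with r h1 h2
      calc ‖NormedSpace.exp (r • B)‖
          = ‖(1 + r • B) + (NormedSpace.exp (r • B) - (1 + r • B))‖ := by
            rw [add_sub_cancel]
        _ ≤ (1 + (ω + ε) * r) + ε * r := (norm_add_le _ _).trans (add_le_add h1 h2)
        _ = (ω + (ε + ε)) * r + 1 := by ring
        _ ≤ _ := Real.add_one_le_exp _
    have hlim : Tendsto (fun n : ℕ ↦ t / ((n : ℝ) + 1)) atTop (𝓝[>] 0) := by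
      refine tendsto_nhdsWithin_iff.2 ⟨?_, Eventually.of_forall fun n ↦ ?_⟩
      · have := (tendsto_one_div_add_atTop_nhds_zero_nat (𝕜 := ℝ)).const_mul t
        simpa [div_eq_mul_inv] using this
      · exact Set.mem_Ioi.2 (by positivity)
    obtain ⟨n, hn⟩ := (hlim.eventually hev).exists
    have hn1 : ((n : ℝ) + 1) ≠ 0 := by positivity
    have hexp : NormedSpace.exp (t • B)
        = NormedSpace.exp ((t / ((n : ℝ) + 1)) • B) ^ (n + 1) := by
      let : NormedAlgebra ℚ 𝔸 := NormedAlgebra.restrictScalars ℚ ℝ 𝔸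
      rw [← NormedSpace.exp_nsmul, ← Nat.cast_smul_eq_nsmul ℝ, smul_smul]
      push_cast
      rw [mul_div_cancel₀ _ hn1]
    rw [hexp]
    refine (norm_pow_le' _ n.succ_pos).trans ?_
    refine (pow_le_pow_left₀ (norm_nonneg _) hn _).trans ?_
    rw [← Real.exp_nat_mul]
    apply le_of_eq
    congr 1
    push_cast
    field_simp
  have hc : Continuous fun ε : ℝ ↦ Real.exp ((ω + (ε + ε)) * t) := by fun_prop
  have hlim : Tendsto (fun ε : ℝ ↦ Real.exp ((ω + (ε + ε)) * t)) (𝓝[>] 0)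
      (𝓝 (Real.exp (ω * t))) := by
    have := hc.tendsto 0
    simp only [add_zero] at this
    exact this.mono_left nhdsWithin_le_nhds
  exact ge_of_tendsto hlim (by filter_upwards [self_mem_nhdsWithin] with ε hε using key ε hε)

end ExponentialGrowth

section LpPairing

variable {Ω : Type*} [MeasurableSpace Ω] {μ : Measure Ω} {p : ℝ≥0∞}

lemma one_le_toReal_of_fact [Fact (1 ≤ p)] (hp : p ≠ ∞) : 1 ≤ p.toReal := by
  simpa using ENNReal.toReal_mono hp (Fact.out : 1 ≤ p)

lemma integrable_norm_rpow_Lp {E : Type*} [NormedAddCommGroup E] [hp1 : Fact (1 ≤ p)]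
    (hp : p ≠ ∞) (F : Lp E p μ) : Integrable (fun x ↦ ‖F x‖ ^ p.toReal) μ :=
  (Lp.memLp F).integrable_norm_rpow (zero_lt_one.trans_le hp1.out).ne' hp

lemma norm_rpow_Lp {E : Type*} [NormedAddCommGroup E] [hp1 : Fact (1 ≤ p)]
    (hp : p ≠ ∞) (F : Lp E p μ) : ‖F‖ ^ p.toReal = ∫ x, ‖F x‖ ^ p.toReal ∂μ := by
  have h0 : 0 < p.toReal := zero_lt_one.trans_le (one_le_toReal_of_fact hp)
  have hn : 0 ≤ ∫ x, ‖F x‖ ^ p.toReal ∂μ := integral_nonneg fun x ↦ by positivity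
  rw [Lp.norm_def, (Lp.memLp F).eLpNorm_eq_integral_rpow_norm
    (zero_lt_one.trans_le hp1.out).ne' hp, ENNReal.toReal_ofReal (by positivity),
    Real.rpow_inv_rpow hn h0.ne']

lemma mul_rpow_sub_one_le {q : ℝ} (hq : 1 ≤ q) {a b : ℝ} (ha : 0 ≤ a) (hb : 0 ≤ b) :
    a * b ^ (q - 1) ≤ a ^ q + b ^ q := by
  have key : ∀ x : ℝ, 0 ≤ x → x * x ^ (q - 1) = x ^ q := by
    intro x hx
    rcases hx.eq_or_lt with rfl | hx
    · rw [zero_mul, Real.zero_rpow (by linarith)]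
    · rw [mul_comm, ← Real.rpow_add_one hx.ne']; congr 1; ring
  have h1 : 0 ≤ a ^ q := by positivity
  have h2 : 0 ≤ b ^ q := by positivity
  rcases le_total a b with h | h
  · have : a * b ^ (q - 1) ≤ b * b ^ (q - 1) := by gcongr
    rw [key b hb] at this; linarith
  · have : a * b ^ (q - 1) ≤ a * a ^ (q - 1) := by gcongr
    rw [key a ha] at this; linarith

lemma integrable_norm_mul_rpow_Lp {E E' : Type*} [NormedAddCommGroup E] [NormedAddCommGroup E']
    [Fact (1 ≤ p)] (hp : p ≠ ∞) (G : Lp E p μ) (F : Lp E' p μ) :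
    Integrable (fun x ↦ ‖G x‖ * ‖F x‖ ^ (p.toReal - 1)) μ := by
  have hq := one_le_toReal_of_fact hp
  refine ((integrable_norm_rpow_Lp hp G).add (integrable_norm_rpow_Lp hp F)).mono' ?_ ?_
  · exact (Lp.stronglyMeasurable G).norm.aestronglyMeasurable.mul
      ((Lp.stronglyMeasurable F).norm.measurable.pow_const _).aestronglyMeasurable
  · refine Filter.Eventually.of_forall fun x ↦ ?_
    rw [Real.norm_eq_abs, abs_of_nonneg (by positivity)]
    exact mul_rpow_sub_one_le hq (norm_nonneg _) (norm_nonneg _)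

lemma integrable_mul_signedPow [Fact (1 ≤ p)] (hp : p ≠ ∞) (k h : Lp ℝ p μ) :
    Integrable (fun x ↦ k x * signedPow p.toReal (h x)) μ := by
  refine (integrable_norm_mul_rpow_Lp hp k h).mono' ?_ (Filter.Eventually.of_forall fun x ↦ ?_)
  · exact (Lp.stronglyMeasurable k).aestronglyMeasurable.mul
      ((measurable_signedPow _).comp (Lp.stronglyMeasurable h).measurable).aestronglyMeasurable
  · rw [norm_mul]
    gcongr
    exact abs_signedPow_le _

lemma integrable_mul_dualityFun [Fact (1 ≤ p)] (hp : p ≠ ∞) (G F : Lp ℂ p μ) :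
    Integrable (fun x ↦ G x * dualityFun p.toReal (F x)) μ := by
  refine (integrable_norm_mul_rpow_Lp hp G F).mono' ?_ (Filter.Eventually.of_forall fun x ↦ ?_)
  · exact (Lp.stronglyMeasurable G).aestronglyMeasurable.mul
      ((measurable_dualityFun _).comp (Lp.stronglyMeasurable F).measurable).aestronglyMeasurable
  · rw [norm_mul]
    gcongr
    exact norm_dualityFun_le _

/-- The duality pairing `∫ G |F| ^ (p - 2) conj F`. -/
noncomputable def dualityPairing (G F : Lp ℂ p μ) : ℂ :=
  ∫ x, G x * dualityFun p.toReal (F x) ∂μ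

lemma norm_dualityPairing_le [Fact (1 ≤ p)] (hp : p ≠ ∞) (G F : Lp ℂ p μ) :
    ‖dualityPairing G F‖ ≤ ‖G‖ ^ p.toReal + ‖F‖ ^ p.toReal := by
  have hq := one_le_toReal_of_fact hp
  rw [norm_rpow_Lp hp, norm_rpow_Lp hp, ← integral_add (integrable_norm_rpow_Lp hp G)
    (integrable_norm_rpow_Lp hp F)]
  refine norm_integral_le_of_norm_le ((integrable_norm_rpow_Lp hp G).add
    (integrable_norm_rpow_Lp hp F)) (Filter.Eventually.of_forall fun x ↦ ?_)
  rw [norm_mul]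
  refine le_trans ?_ (mul_rpow_sub_one_le hq (norm_nonneg _) (norm_nonneg _))
  gcongr
  exact norm_dualityFun_le _

lemma dualityPairing_smul [Fact (1 ≤ p)] (z : ℂ) (G F : Lp ℂ p μ) :
    dualityPairing (z • G) F = z * dualityPairing G F := by
  rw [dualityPairing, dualityPairing, ← integral_const_mul]
  refine integral_congr_ae ?_
  filter_upwards [Lp.coeFn_smul z G] with x hx
  simp [hx, mul_assoc]

lemma norm_rpow_add_re_dualityPairing_le [Fact (1 ≤ p)] (hp : p ≠ ∞) (F G : Lp ℂ p μ) :
    ‖F‖ ^ p.toReal + p.toReal * (dualityPairing G F).re ≤ ‖F + G‖ ^ p.toReal := by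
  have h_int := integrable_mul_dualityFun hp G F
  have h_int_re : Integrable (fun x ↦ (G x * dualityFun p.toReal (F x)).re) μ := h_int.re
  have hre : (dualityPairing G F).re = ∫ x, (G x * dualityFun p.toReal (F x)).re ∂μ :=
    (integral_re h_int).symm
  rw [hre, norm_rpow_Lp hp, norm_rpow_Lp hp, ← integral_const_mul,
    ← integral_add (integrable_norm_rpow_Lp hp F) (h_int_re.const_mul _)]
  refine integral_mono_ae ((integrable_norm_rpow_Lp hp F).add (h_int_re.const_mul _))
    (integrable_norm_rpow_Lp hp _) ?_
  filter_upwards [Lp.coeFn_add F G] with x hx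
  rw [hx]
  exact norm_rpow_add_mul_re_le (one_le_toReal_of_fact hp) (F x) (G x)

lemma norm_rpow_add_integral_signedPow_le [Fact (1 ≤ p)] (hp : p ≠ ∞) (h k : Lp ℝ p μ) :
    ‖h‖ ^ p.toReal + p.toReal * ∫ x, k x * signedPow p.toReal (h x) ∂μ
      ≤ ‖h + k‖ ^ p.toReal := by
  have h_int := integrable_mul_signedPow hp k h
  rw [norm_rpow_Lp hp, norm_rpow_Lp hp, ← integral_const_mul,
    ← integral_add (integrable_norm_rpow_Lp hp h) (h_int.const_mul _)]
  refine integral_mono_ae ((integrable_norm_rpow_Lp hp h).add (h_int.const_mul _))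
    (integrable_norm_rpow_Lp hp _) ?_
  filter_upwards [Lp.coeFn_add h k] with x hx
  rw [hx]
  exact abs_rpow_add_mul_le (one_le_toReal_of_fact hp) (h x) (k x)

open Filter Topology in
/-- Generators of contractive semigroups on `L^p` are dissipative. -/
lemma integral_mul_signedPow_nonpos [Fact (1 ≤ p)] (hp : p ≠ ∞) {A : Lp ℝ p μ →L[ℝ] Lp ℝ p μ}
    (hA : ∀ t : ℝ, 0 ≤ t → ‖NormedSpace.exp (t • A)‖ ≤ 1) (h : Lp ℝ p μ) :
    ∫ x, A h x * signedPow p.toReal (h x) ∂μ ≤ 0 := by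
  set q := p.toReal with hq_def
  have hq : 1 ≤ q := one_le_toReal_of_fact hp
  set J := ∫ x, A h x * signedPow q (h x) ∂μ with hJ
  have key : ∀ ε > 0, J ≤ ε * (2 * ‖h‖ ^ q) := by
    intro ε hε
    have hsmall : ∀ᶠ r : ℝ in 𝓝[>] 0, q * ε * r < 1 := by
      have hc : Continuous fun r : ℝ ↦ q * ε * r := by fun_prop
      have : ∀ᶠ r : ℝ in 𝓝 0, q * ε * r < 1 :=
        hc.continuousAt.eventually_lt continuousAt_const (by simp)
      exact this.filter_mono nhdsWithin_le_nhds
    obtain ⟨r, hr1, hr2, hr0⟩ := ((eventually_norm_exp_smul_sub_le A hε).and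
      (hsmall.and self_mem_nhdsWithin)).exists
    have hr0 : 0 < r := hr0
    have hsub := norm_rpow_add_integral_signedPow_le hp h (r • A h)
    have h_int : ∫ x, (r • A h : Lp ℝ p μ) x * signedPow q (h x) ∂μ = r * J := by
      rw [hJ, ← integral_const_mul]
      refine integral_congr_ae ?_
      filter_upwards [Lp.coeFn_smul r (A h)] with x hx
      simp [hx, mul_assoc]
    rw [← hq_def, h_int] at hsub
    have hnorm : ‖h + r • A h‖ ≤ Real.exp (ε * r) * ‖h‖ := by
      have e1 : h + r • A h = NormedSpace.exp (r • A) h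
          - (NormedSpace.exp (r • A) - (1 + r • A)) h := by
        simp
      have e2 := (NormedSpace.exp (r • A)).le_of_opNorm_le (hA r hr0.le) h
      have e3 := (NormedSpace.exp (r • A) - (1 + r • A)).le_of_opNorm_le hr1 h
      have e4 := Real.add_one_le_exp (ε * r)
      rw [e1]
      refine (norm_sub_le _ _).trans ?_
      nlinarith [norm_nonneg h]
    have hpow : ‖h + r • A h‖ ^ q ≤ (1 + 2 * (q * ε * r)) * ‖h‖ ^ q := by
      refine (Real.rpow_le_rpow (norm_nonneg _) hnorm (by linarith)).trans ?_
      rw [Real.mul_rpow (by positivity) (by positivity), ← Real.exp_mul]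
      gcongr
      have hx0 : 0 ≤ q * ε * r := by positivity
      have hb := Real.abs_exp_sub_one_sub_id_le (x := q * ε * r)
        (by rw [abs_of_nonneg hx0]; linarith)
      have hb2 := (abs_le.1 hb).2
      have : ε * r * q = q * ε * r := by ring
      rw [this]
      nlinarith
    have hqr : 0 < q * r := by positivity
    have : q * r * J ≤ q * r * (ε * (2 * ‖h‖ ^ q)) := by linarith
    exact le_of_mul_le_mul_left this hqr
  by_contra! hcon
  have hH : 0 ≤ 2 * ‖h‖ ^ q := by positivity
  have h1 := key (J / (2 * (2 * ‖h‖ ^ q + 1))) (by positivity)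
  have h2 : J / (2 * (2 * ‖h‖ ^ q + 1)) * (2 * ‖h‖ ^ q) ≤ J / 2 := by
    rw [div_mul_eq_mul_div, div_le_div_iff₀ (by positivity) (by positivity)]
    nlinarith
  linarith

open Filter Topology in
/-- A bound on the numerical range of `T` gives a growth bound for the semigroup it generates. -/
lemma norm_exp_smul_le_of_re_dualityPairing_le [Fact (1 ≤ p)] (hp : p ≠ ∞)
    {T : Lp ℂ p μ →L[ℂ] Lp ℂ p μ} {ω : ℝ} (hω : 0 ≤ ω)
    (hT : ∀ F, (dualityPairing (T F) F).re ≤ ω * ‖F‖ ^ p.toReal) {t : ℝ} (ht : 0 < t) :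
    ‖NormedSpace.exp (t • T)‖ ≤ Real.exp (p.toReal * ω * t) := by
  set q := p.toReal with hq_def
  have hq : 1 ≤ q := one_le_toReal_of_fact hp
  refine norm_exp_smul_le_of_eventually (𝔸 := Lp ℂ p μ →L[ℂ] Lp ℂ p μ) (B := T)
    (ω := q * ω) (fun ε hε ↦ ?_) ht
  have hsmall : ∀ᶠ r : ℝ in 𝓝[>] 0, q * ω * r < 1 := by
    have hc : Continuous fun r : ℝ ↦ q * ω * r := by fun_prop
    have : ∀ᶠ r : ℝ in 𝓝 0, q * ω * r < 1 :=
      hc.continuousAt.eventually_lt continuousAt_const (by simp)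
    exact this.filter_mono nhdsWithin_le_nhds
  have hsmall2 : ∀ᶠ r : ℝ in 𝓝[>] 0, r * (‖T‖ ^ 2 + q * ω * (q * ω + ε)) < ε := by
    have hc : Continuous fun r : ℝ ↦ r * (‖T‖ ^ 2 + q * ω * (q * ω + ε)) := by fun_prop
    have : ∀ᶠ r : ℝ in 𝓝 0, r * (‖T‖ ^ 2 + q * ω * (q * ω + ε)) < ε :=
      hc.continuousAt.eventually_lt continuousAt_const (by simpa using hε)
    exact this.filter_mono nhdsWithin_le_nhds
  filter_upwards [hsmall, hsmall2, self_mem_nhdsWithin] with r hr1 hr2 hr0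
  have hr0 : 0 < r := hr0
  have hu0 : 0 ≤ q * ω * r := by positivity
  have hlower : ∀ F : Lp ℂ p μ, (1 - q * ω * r) * ‖F‖ ≤ ‖F - r • T F‖ := by
    intro F
    have hsub := norm_rpow_add_re_dualityPairing_le hp F (((-r : ℝ) : ℂ) • T F)
    rw [dualityPairing_smul, Complex.re_ofReal_mul] at hsub
    have e1 : F + ((-r : ℝ) : ℂ) • T F = F - r • T F := by
      rw [Complex.coe_smul, sub_eq_add_neg]
      exact congrArg (F + ·) (neg_smul r (T F))
    rw [e1, ← hq_def] at hsub
    have h1 : (1 - q * ω * r) * ‖F‖ ^ q ≤ ‖F - r • T F‖ ^ q := by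
      have := mul_le_mul_of_nonneg_left (hT F) (by positivity : 0 ≤ q * r)
      linarith
    have h2 : ((1 - q * ω * r) * ‖F‖) ^ q ≤ (1 - q * ω * r) * ‖F‖ ^ q := by
      rw [Real.mul_rpow (by linarith) (norm_nonneg _)]
      gcongr
      exact Real.rpow_le_self_of_le_one (by linarith) (by linarith) hq
    exact (Real.rpow_le_rpow_iff (by
      have : 0 ≤ 1 - q * ω * r := by linarith
      positivity) (norm_nonneg _) (by linarith : 0 < q)).1 (h2.trans h1)
  refine ContinuousLinearMap.opNorm_le_bound _ (by positivity) fun F ↦ ?_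
  have h1 := hlower ((1 + r • T) F)
  have e2 : (1 + r • T) F - r • T ((1 + r • T) F) = F - (r ^ 2) • T (T F) := by
    have : T (r • T F) = r • T (T F) := T.map_smul_of_tower r (T F)
    simp only [add_apply, one_apply_eq_self, smul_apply, map_add, this, smul_add, smul_smul, sq]
    abel
  rw [e2] at h1
  have h2 : ‖F - (r ^ 2) • T (T F)‖ ≤ (1 + r ^ 2 * ‖T‖ ^ 2) * ‖F‖ := by
    refine (norm_sub_le _ _).trans ?_
    rw [norm_smul, Real.norm_eq_abs, abs_of_nonneg (by positivity : 0 ≤ r ^ 2)]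
    have h3 : ‖T (T F)‖ ≤ ‖T‖ * (‖T‖ * ‖F‖) := T.le_opNorm_of_le (T.le_opNorm F)
    have := mul_le_mul_of_nonneg_left h3 (by positivity : 0 ≤ r ^ 2)
    linarith
  have h4 : 1 + r ^ 2 * ‖T‖ ^ 2 ≤ (1 - q * ω * r) * (1 + (q * ω + ε) * r) := by nlinarith
  have h5 : (1 - q * ω * r) * ‖(1 + r • T) F‖
      ≤ (1 - q * ω * r) * ((1 + (q * ω + ε) * r) * ‖F‖) := by
    rw [← mul_assoc]
    exact h1.trans (h2.trans (mul_le_mul_of_nonneg_right h4 (norm_nonneg _)))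
  exact le_of_mul_le_mul_left h5 (by linarith)

end LpPairing

section Complexification

variable {Ω : Type*} [MeasurableSpace Ω] {μ : Measure Ω} {p : ℝ≥0∞}

/-- The pointwise real part on `L^p`. -/
noncomputable def lpRe (p : ℝ≥0∞) [Fact (1 ≤ p)] (μ : Measure Ω) : Lp ℂ p μ →L[ℝ] Lp ℝ p μ :=
  Complex.reCLM.compLpL p μ

/-- The pointwise imaginary part on `L^p`. -/
noncomputable def lpIm (p : ℝ≥0∞) [Fact (1 ≤ p)] (μ : Measure Ω) : Lp ℂ p μ →L[ℝ] Lp ℝ p μ :=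
  Complex.imCLM.compLpL p μ

/-- The inclusion of real `L^p` into complex `L^p`. -/
noncomputable def lpOfReal (p : ℝ≥0∞) [Fact (1 ≤ p)] (μ : Measure Ω) :
    Lp ℝ p μ →L[ℝ] Lp ℂ p μ :=
  Complex.ofRealCLM.compLpL p μ

variable [Fact (1 ≤ p)]

lemma coeFn_lpRe (F : Lp ℂ p μ) : lpRe p μ F =ᵐ[μ] fun x ↦ (F x).re :=
  Complex.reCLM.coeFn_compLpL F

lemma coeFn_lpIm (F : Lp ℂ p μ) : lpIm p μ F =ᵐ[μ] fun x ↦ (F x).im :=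
  Complex.imCLM.coeFn_compLpL F

lemma coeFn_lpOfReal (f : Lp ℝ p μ) : lpOfReal p μ f =ᵐ[μ] fun x ↦ ((f x : ℝ) : ℂ) :=
  Complex.ofRealCLM.coeFn_compLpL f

lemma norm_lpOfReal (f : Lp ℝ p μ) : ‖lpOfReal p μ f‖ = ‖f‖ := by
  refine le_antisymm (Lp.norm_le_norm_of_ae_le ?_) (Lp.norm_le_norm_of_ae_le ?_) <;>
  · filter_upwards [coeFn_lpOfReal f] with x hx
    simp [hx]

lemma norm_lpRe_le (F : Lp ℂ p μ) : ‖lpRe p μ F‖ ≤ ‖F‖ := by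
  refine Lp.norm_le_norm_of_ae_le ?_
  filter_upwards [coeFn_lpRe F] with x hx
  rw [hx]
  exact Complex.abs_re_le_norm _

lemma norm_lpIm_le (F : Lp ℂ p μ) : ‖lpIm p μ F‖ ≤ ‖F‖ := by
  refine Lp.norm_le_norm_of_ae_le ?_
  filter_upwards [coeFn_lpIm F] with x hx
  rw [hx]
  exact Complex.abs_im_le_norm _

lemma lpRe_smul (c : ℂ) (F : Lp ℂ p μ) :
    lpRe p μ (c • F) = c.re • lpRe p μ F - c.im • lpIm p μ F := by
  refine Lp.ext ?_
  filter_upwards [coeFn_lpRe (c • F), Lp.coeFn_sub (c.re • lpRe p μ F) (c.im • lpIm p μ F),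
    Lp.coeFn_smul c.re (lpRe p μ F), Lp.coeFn_smul c.im (lpIm p μ F), coeFn_lpRe F, coeFn_lpIm F,
    Lp.coeFn_smul c F] with x h1 h2 h3 h4 h5 h6 h7
  rw [h1, h2, Pi.sub_apply, h3, h4, h7]
  simp [h5, h6]

lemma lpIm_smul (c : ℂ) (F : Lp ℂ p μ) :
    lpIm p μ (c • F) = c.re • lpIm p μ F + c.im • lpRe p μ F := by
  refine Lp.ext ?_
  filter_upwards [coeFn_lpIm (c • F), Lp.coeFn_add (c.re • lpIm p μ F) (c.im • lpRe p μ F),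
    Lp.coeFn_smul c.im (lpRe p μ F), Lp.coeFn_smul c.re (lpIm p μ F), coeFn_lpRe F, coeFn_lpIm F,
    Lp.coeFn_smul c F] with x h1 h2 h3 h4 h5 h6 h7
  rw [h1, h2, Pi.add_apply, h3, h4, h7]
  simp [h5, h6]

lemma lpOfReal_smul (r : ℝ) (f : Lp ℝ p μ) : lpOfReal p μ (r • f) = (r : ℂ) • lpOfReal p μ f := by
  refine Lp.ext ?_
  filter_upwards [coeFn_lpOfReal (r • f), Lp.coeFn_smul (r : ℂ) (lpOfReal p μ f),
    Lp.coeFn_smul r f, coeFn_lpOfReal f] with x h1 h2 h3 h4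
  rw [h1, h2, h3]
  simp [h4]

lemma lpRe_lpOfReal (f : Lp ℝ p μ) : lpRe p μ (lpOfReal p μ f) = f := by
  refine Lp.ext ?_
  filter_upwards [coeFn_lpRe (lpOfReal p μ f), coeFn_lpOfReal f] with x h1 h2
  simp [h1, h2]

lemma lpIm_lpOfReal (f : Lp ℝ p μ) : lpIm p μ (lpOfReal p μ f) = 0 := by
  refine Lp.ext ?_
  filter_upwards [coeFn_lpIm (lpOfReal p μ f), coeFn_lpOfReal f, Lp.coeFn_zero ℝ p μ]
    with x h1 h2 h3
  rw [h1, h2, h3, Complex.ofReal_im, Pi.zero_apply]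

/-- The complexification of a bounded operator on real `L^p`. -/
noncomputable def complexify (A : Lp ℝ p μ →L[ℝ] Lp ℝ p μ) : Lp ℂ p μ →L[ℂ] Lp ℂ p μ :=
  LinearMap.mkContinuous
    { toFun F := lpOfReal p μ (A (lpRe p μ F)) + Complex.I • lpOfReal p μ (A (lpIm p μ F))
      map_add' F G := by
        simp only [map_add, smul_add]
        abel
      map_smul' c F := by
        simp only [lpRe_smul, lpIm_smul, map_add, map_sub, A.map_smul, lpOfReal_smul,
          RingHom.id_apply]
        match_scalars <;> apply Complex.ext <;> simp }
    (2 * ‖A‖) fun F ↦ by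
      refine (norm_add_le _ _).trans ?_
      rw [norm_smul, Complex.norm_I, one_mul, norm_lpOfReal, norm_lpOfReal]
      have h1 := A.le_opNorm_of_le (norm_lpRe_le F)
      have h2 := A.le_opNorm_of_le (norm_lpIm_le F)
      linarith

lemma complexify_apply (A : Lp ℝ p μ →L[ℝ] Lp ℝ p μ) (F : Lp ℂ p μ) :
    complexify A F
      = lpOfReal p μ (A (lpRe p μ F)) + Complex.I • lpOfReal p μ (A (lpIm p μ F)) := rfl

lemma norm_complexify_le (A : Lp ℝ p μ →L[ℝ] Lp ℝ p μ) : ‖complexify A‖ ≤ 2 * ‖A‖ :=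
  LinearMap.mkContinuous_norm_le _ (by positivity) _

lemma complexify_lpOfReal (A : Lp ℝ p μ →L[ℝ] Lp ℝ p μ) (f : Lp ℝ p μ) :
    complexify A (lpOfReal p μ f) = lpOfReal p μ (A f) := by
  simp [complexify_apply, lpRe_lpOfReal, lpIm_lpOfReal]

lemma lpRe_complexify (A : Lp ℝ p μ →L[ℝ] Lp ℝ p μ) (F : Lp ℂ p μ) :
    lpRe p μ (complexify A F) = A (lpRe p μ F) := by
  simp [complexify_apply, lpRe_smul, lpRe_lpOfReal, lpIm_lpOfReal]

lemma smul_complexify_pow_lpOfReal (A : Lp ℝ p μ →L[ℝ] Lp ℝ p μ) (t : ℝ) (f : Lp ℝ p μ) (n : ℕ) :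
    (((t : ℂ) • complexify A) ^ n) (lpOfReal p μ f) = lpOfReal p μ (((t • A) ^ n) f) := by
  induction n generalizing f with
  | zero => rfl
  | succ n ih =>
    rw [pow_succ, pow_succ, mul_apply_eq_comp, mul_apply_eq_comp, ← ih,
      smul_apply, complexify_lpOfReal, smul_apply, lpOfReal_smul]

lemma exp_complexify_lpOfReal (A : Lp ℝ p μ →L[ℝ] Lp ℝ p μ) (t : ℝ) (f : Lp ℝ p μ) :
    NormedSpace.exp ((t : ℂ) • complexify A) (lpOfReal p μ f)
      = lpOfReal p μ (NormedSpace.exp (t • A) f) := by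
  have h1 := (NormedSpace.exp_series_hasSum_exp' (𝕂 := ℝ) (t • A)).mapL
    ((lpOfReal p μ).comp (ContinuousLinearMap.apply ℝ (Lp ℝ p μ) f))
  have h2 := (NormedSpace.exp_series_hasSum_exp' (𝕂 := ℝ) ((t : ℂ) • complexify A)).mapL
    ((ContinuousLinearMap.apply ℂ (Lp ℂ p μ) (lpOfReal p μ f)).restrictScalars ℝ)
  refine h2.unique ?_
  refine h1.congr_fun fun n ↦ ?_
  change (n.factorial⁻¹ : ℝ) • (((t : ℂ) • complexify A) ^ n) (lpOfReal p μ f)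
    = lpOfReal p μ ((n.factorial⁻¹ : ℝ) • ((t • A) ^ n) f)
  rw [smul_complexify_pow_lpOfReal, map_smul]

lemma integral_complexify_re_nonpos (hp : p ≠ ∞) {A : Lp ℝ p μ →L[ℝ] Lp ℝ p μ}
    (hA : ∀ t : ℝ, 0 ≤ t → ‖NormedSpace.exp (t • A)‖ ≤ 1) (H : Lp ℂ p μ) :
    ∫ x, (complexify A H x).re * signedPow p.toReal (H x).re ∂μ ≤ 0 := by
  refine le_of_eq_of_le (integral_congr_ae ?_) (integral_mul_signedPow_nonpos hp hA (lpRe p μ H))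
  filter_upwards [coeFn_lpRe H, coeFn_lpRe (complexify A H)] with x h1 h2
  rw [← lpRe_complexify, h1, h2]

end Complexification

section Averaging

variable {Ω : Type*} [MeasurableSpace Ω] {μ : Measure Ω} {p : ℝ≥0∞}

lemma abs_circleRe_le_add (c z w : ℂ) (θ : ℝ) : |circleRe c z w θ| ≤ ‖z‖ + ‖c‖ * ‖w‖ := by
  refine (Complex.abs_re_le_norm _).trans ((norm_add_le _ _).trans (le_of_eq ?_))
  have h : (3 * θ : ℂ) = ((3 * θ : ℝ) : ℂ) := by push_cast; rfl
  rw [norm_mul, norm_mul, norm_mul, h, Complex.norm_exp_ofReal_mul_I,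
    Complex.norm_exp_ofReal_mul_I, one_mul, mul_one]

lemma abs_circleRe_mul_signedPow_le {q : ℝ} (hq : 1 ≤ q) (c z u w : ℂ) (θ : ℝ) :
    |circleRe c u w θ * signedPow q (circleRe c z (tripleArg z) θ)|
      ≤ (‖u‖ + ‖c‖ * ‖w‖) * ((1 + ‖c‖) ^ (q - 1) * ‖z‖ ^ (q - 1)) := by
  rw [abs_mul, ← Real.mul_rpow (by positivity) (by positivity)]
  gcongr
  · exact abs_circleRe_le_add c u w θ
  · refine (abs_signedPow_le _).trans ?_
    have h := abs_circleRe_le_add c z (tripleArg z) θ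
    rw [norm_tripleArg] at h
    refine Real.rpow_le_rpow (abs_nonneg _) ?_ (by linarith)
    linarith

lemma intervalIntegrable_mul_signedPow_tripleArg {q : ℝ} (hq : 1 ≤ q) (c z : ℂ) {f : ℝ → ℂ}
    (hf : Continuous f) (a b : ℝ) :
    IntervalIntegrable (fun θ ↦ f θ * signedPow q (circleRe c z (tripleArg z) θ)) volume a b := by
  have hc : Continuous fun θ ↦ ‖f θ‖ * |circleRe c z (tripleArg z) θ| ^ (q - 1) :=
    hf.norm.mul
      ((continuous_circleRe c z _).abs.rpow_const fun _ ↦ Or.inr (by linarith))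
  refine (hc.intervalIntegrable a b).mono_fun' ?_ (Filter.Eventually.of_forall fun θ ↦ ?_)
  · exact (hf.measurable.mul (Complex.measurable_ofReal.comp
      ((measurable_signedPow q).comp (continuous_circleRe c z _).measurable))).aestronglyMeasurable
  · simp only [norm_mul, Complex.norm_real]
    gcongr
    exact abs_signedPow_le _

lemma integral_circleRe_mul_signedPow {q : ℝ} (hq : 1 ≤ q) (c z u w : ℂ) :
    ∫ θ in (0 : ℝ)..(2 * Real.pi),
        circleRe c u w θ * signedPow q (circleRe c z (tripleArg z) θ)
      = (circleCoeff q 1 c * (u * dualityFun q z)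
        + c * circleCoeff q 3 c * (w * dualityFun q (tripleArg z))).re := by
  have h1 := intervalIntegrable_mul_signedPow_tripleArg hq c z
    (f := fun θ ↦ Complex.exp (θ * Complex.I)) (by fun_prop) 0 (2 * Real.pi)
  have h3 := intervalIntegrable_mul_signedPow_tripleArg hq c z
    (f := fun θ ↦ Complex.exp (3 * θ * Complex.I)) (by fun_prop) 0 (2 * Real.pi)
  have e : circleCoeff q 1 c * (u * dualityFun q z)
        + c * circleCoeff q 3 c * (w * dualityFun q (tripleArg z))
      = ∫ θ in (0 : ℝ)..(2 * Real.pi),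
          (u * (Complex.exp (θ * Complex.I) * signedPow q (circleRe c z (tripleArg z) θ))
            + c * w * (Complex.exp (3 * θ * Complex.I)
              * signedPow q (circleRe c z (tripleArg z) θ))) := by
    rw [intervalIntegral.integral_add (h1.const_mul _) (h3.const_mul _),
      intervalIntegral.integral_const_mul, intervalIntegral.integral_const_mul,
      integral_exp_one_mul_signedPow, integral_exp_three_mul_signedPow]
    ring
  rw [e, intervalIntegral_re ((h1.const_mul _).add (h3.const_mul _))]
  refine intervalIntegral.integral_congr fun θ _ ↦ ?_
  simp only [circleRe]
  rw [← Complex.re_mul_ofReal]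
  congr 1
  ring

/-- Averaging the dissipativity of `B` along circles yields a relation between the duality
pairings of `F` and of its argument tripling. -/
lemma re_dualityPairing_average_nonpos [Fact (1 ≤ p)] (hp : p ≠ ∞)
    {B : Lp ℂ p μ →L[ℂ] Lp ℂ p μ}
    (hB : ∀ H, ∫ x, (B H x).re * signedPow p.toReal (H x).re ∂μ ≤ 0)
    {F F₃ : Lp ℂ p μ} (hF₃ : F₃ =ᵐ[μ] fun x ↦ tripleArg (F x)) (c : ℂ) :
    (circleCoeff p.toReal 1 c * dualityPairing (B F) F
      + c * circleCoeff p.toReal 3 c * dualityPairing (B F₃) F₃).re ≤ 0 := by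
  have hp0 : p ≠ 0 := (zero_lt_one.trans_le (Fact.out : 1 ≤ p)).ne'
  set q := p.toReal
  have hq : 1 ≤ q := one_le_toReal_of_fact hp
  set k : ℝ → Ω → ℝ := fun θ x ↦ circleRe c (B F x) (B F₃ x) θ
    * signedPow q (circleRe c (F x) (tripleArg (F x)) θ) with hk
  have hk_int : ∀ θ, ∫ x, k θ x ∂μ ≤ 0 := by
    intro θ
    refine le_of_eq_of_le (integral_congr_ae ?_) (hB (Complex.exp (θ * Complex.I) • F
      + (c * Complex.exp (3 * θ * Complex.I)) • F₃))
    rw [map_add, map_smul, map_smul]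
    filter_upwards [hF₃, Lp.coeFn_add (Complex.exp (θ * Complex.I) • F)
      ((c * Complex.exp (3 * θ * Complex.I)) • F₃), Lp.coeFn_smul (Complex.exp (θ * Complex.I)) F,
      Lp.coeFn_smul (c * Complex.exp (3 * θ * Complex.I)) F₃,
      Lp.coeFn_add (Complex.exp (θ * Complex.I) • B F)
      ((c * Complex.exp (3 * θ * Complex.I)) • B F₃),
      Lp.coeFn_smul (Complex.exp (θ * Complex.I)) (B F),
      Lp.coeFn_smul (c * Complex.exp (3 * θ * Complex.I)) (B F₃)] with x h h1 h2 h3 h4 h5 h6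
    rw [h1, h4, Pi.add_apply, Pi.add_apply, h2, h3, h5, h6]
    simp only [Pi.smul_apply, smul_eq_mul, h]
    rfl
  obtain ⟨S, hS, hFS, hσ⟩ := (Lp.finStronglyMeasurable F hp0 hp).exists_set_sigmaFinite
  have hkS : ∀ θ, ∫ x in S, k θ x ∂μ = ∫ x, k θ x ∂μ := by
    intro θ
    refine setIntegral_eq_integral_of_forall_compl_eq_zero fun x hx ↦ ?_
    simp [hk, hFS x hx, tripleArg, circleRe, signedPow]
  have hbound : Integrable (fun x ↦ (‖B F x‖ + ‖c‖ * ‖B F₃ x‖)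
      * ((1 + ‖c‖) ^ (q - 1) * ‖F x‖ ^ (q - 1))) μ := by
    have h1 := (integrable_norm_mul_rpow_Lp hp (B F) F).const_mul ((1 + ‖c‖) ^ (q - 1))
    have h2 := (integrable_norm_mul_rpow_Lp hp (B F₃) F).const_mul (‖c‖ * (1 + ‖c‖) ^ (q - 1))
    refine (h1.add h2).congr (Filter.Eventually.of_forall fun x ↦ ?_)
    simp only [Pi.add_apply]
    ring
  have hF_meas := (Lp.stronglyMeasurable F).measurable
  have hBF_meas := (Lp.stronglyMeasurable (B F)).measurable
  have hBF₃_meas := (Lp.stronglyMeasurable (B F₃)).measurable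
  have hk_meas : Measurable (Function.uncurry k) := by
    have hm1 : Measurable fun y : ℝ × Ω ↦ circleRe c (B F y.2) (B F₃ y.2) y.1 := by
      unfold circleRe
      fun_prop
    have hm2 : Measurable fun y : ℝ × Ω ↦ circleRe c (F y.2) (tripleArg (F y.2)) y.1 := by
      have := measurable_tripleArg
      unfold circleRe
      fun_prop
    exact hm1.mul ((measurable_signedPow q).comp hm2)
  have hk_prod : Integrable (Function.uncurry k)
      ((volume.restrict (Set.uIoc 0 (2 * Real.pi))).prod (μ.restrict S)) := by
    have : IsFiniteMeasure (volume.restrict (Set.uIoc 0 (2 * Real.pi))) := by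
      rw [Set.uIoc_of_le Real.two_pi_pos.le]
      infer_instance
    refine ((hbound.mono_measure Measure.restrict_le_self).comp_snd _).mono'
      hk_meas.aestronglyMeasurable (Filter.Eventually.of_forall fun y ↦ ?_)
    exact abs_circleRe_mul_signedPow_le hq c _ _ _ _
  have hswap := intervalIntegral_integral_swap hk_prod
  have hneg : ∫ θ in (0 : ℝ)..(2 * Real.pi), ∫ x in S, k θ x ∂μ ≤ 0 := by
    simp only [hkS]
    have := intervalIntegral.integral_nonneg (f := fun θ ↦ -∫ x, k θ x ∂μ) (μ := volume)
      Real.two_pi_pos.le fun θ _ ↦ neg_nonneg.2 (hk_int θ)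
    rw [intervalIntegral.integral_neg] at this
    linarith
  rw [hswap] at hneg
  simp only [hk, integral_circleRe_mul_signedPow hq] at hneg
  have hP1 := integrable_mul_dualityFun hp (B F) F
  have hP3 := integrable_mul_dualityFun hp (B F₃) F₃
  have hP3_congr : (fun x ↦ B F₃ x * dualityFun q (F₃ x))
      =ᵐ[μ] fun x ↦ B F₃ x * dualityFun q (tripleArg (F x)) := by
    filter_upwards [hF₃] with x hx
    rw [hx]
  have hP3' := hP3.congr hP3_congr
  rw [setIntegral_eq_integral_of_forall_compl_eq_zero] at hneg
  · refine le_of_eq_of_le ?_ hneg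
    rw [dualityPairing, dualityPairing, integral_congr_ae hP3_congr, ← integral_const_mul,
      ← integral_const_mul, ← integral_add (hP1.const_mul _) (hP3'.const_mul _)]
    exact (integral_re ((hP1.const_mul _).add (hP3'.const_mul _))).symm
  · intro x hx
    simp [hFS x hx, tripleArg, dualityFun]

end Averaging

section NumericalRange

lemma exists_ae_eq_tripleArg {Ω : Type*} [MeasurableSpace Ω] {μ : Measure Ω} {p : ℝ≥0∞}
    (F : Lp ℂ p μ) : ∃ F₃ : Lp ℂ p μ, F₃ =ᵐ[μ] (fun x ↦ tripleArg (F x)) ∧ ‖F₃‖ = ‖F‖ := by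
  have hmem : MemLp (fun x ↦ tripleArg (F x)) p μ :=
    (Lp.memLp F).of_le
      (measurable_tripleArg.comp (Lp.stronglyMeasurable F).measurable).aestronglyMeasurable
      (Filter.Eventually.of_forall fun x ↦ (norm_tripleArg _).le)
  refine ⟨hmem.toLp _, hmem.coeFn_toLp, ?_⟩
  refine le_antisymm (Lp.norm_le_norm_of_ae_le ?_) (Lp.norm_le_norm_of_ae_le ?_) <;>
  · filter_upwards [hmem.coeFn_toLp] with x hx
    rw [hx, norm_tripleArg]

/-- For `p ≠ 2`, the numerical range of a complexified dissipative operator on `L^p` is, up to an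
arbitrarily small error, contained in a sector around the negative half-axis. -/
lemma exists_abs_im_dualityPairing_le {p : ℝ≥0∞} [Fact (1 ≤ p)] (hp : p ≠ ∞)
    (hp2 : p.toReal ≠ 2) (n : ℕ) :
    ∃ K : ℝ, 0 ≤ K ∧ ∀ (Ω : Type*) (_ : MeasurableSpace Ω) (μ : Measure Ω)
      (B : Lp ℂ p μ →L[ℂ] Lp ℂ p μ), ‖B‖ ≤ 2 →
      (∀ H, ∫ x, (B H x).re * signedPow p.toReal (H x).re ∂μ ≤ 0) → ∀ F,
        (dualityPairing (B F) F).re ≤ 0 ∧ |(dualityPairing (B F) F).im|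
          ≤ (2 ^ p.toReal + 1) / 3 ^ n * ‖F‖ ^ p.toReal + K * -(dualityPairing (B F) F).re := by
  have hq : 1 ≤ p.toReal := one_le_toReal_of_fact hp
  obtain ⟨C, hC0, hC⟩ := exists_norm_sub_le_of_re_circleCoeff_nonpos hq hp2
  induction n with
  | zero =>
    refine ⟨0, le_rfl, fun Ω _ μ B hB2 hB F ↦ ?_⟩
    obtain ⟨F₃, hF₃, -⟩ := exists_ae_eq_tripleArg F
    refine ⟨(hC _ _ (re_dualityPairing_average_nonpos hp hB hF₃)).1, ?_⟩
    have h1 := (Complex.abs_im_le_norm _).trans (norm_dualityPairing_le hp (B F) F)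
    have h2 : ‖B F‖ ^ p.toReal ≤ 2 ^ p.toReal * ‖F‖ ^ p.toReal := by
      rw [← Real.mul_rpow (by norm_num) (norm_nonneg _)]
      exact Real.rpow_le_rpow (norm_nonneg _) (B.le_of_opNorm_le hB2 F) (by linarith)
    rw [pow_zero, div_one, zero_mul, add_zero]
    linarith
  | succ n ih =>
    obtain ⟨K, hK0, hK⟩ := ih
    refine ⟨(K * C + C) / 3, by positivity, fun Ω _ μ B hB2 hB F ↦ ?_⟩
    obtain ⟨F₃, hF₃, hnorm⟩ := exists_ae_eq_tripleArg F
    obtain ⟨hre, hsub⟩ := hC _ _ (re_dualityPairing_average_nonpos hp hB hF₃)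
    refine ⟨hre, ?_⟩
    obtain ⟨-, him₃⟩ := hK Ω _ μ B hB2 hB F₃
    have h1 := (Complex.abs_re_le_norm _).trans hsub
    have h2 := (Complex.abs_im_le_norm _).trans hsub
    simp only [Complex.sub_re, Complex.sub_im, Complex.mul_re, Complex.mul_im, Complex.I_re,
      Complex.I_im, Complex.ofReal_re, Complex.ofReal_im, Complex.re_ofNat, Complex.im_ofNat,
      mul_zero, mul_one, zero_mul, sub_zero, add_zero] at h1 h2
    rw [hnorm] at him₃
    set a := dualityPairing (B F) F
    set b := dualityPairing (B F₃) F₃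
    set N := ‖F‖ ^ p.toReal
    have h3 : -b.re ≤ C * -a.re := (neg_le_abs _).trans h1
    have h4 : 3 * |a.im| ≤ |b.im| + C * -a.re := by
      have : |3 * a.im| ≤ |b.im| + |b.im - 3 * a.im| := by
        rw [abs_sub_comm]
        simpa using abs_add_le b.im (3 * a.im - b.im)
      rw [abs_mul, abs_of_pos (by norm_num : (0 : ℝ) < 3)] at this
      linarith
    have h5 := mul_le_mul_of_nonneg_left h3 hK0
    have h6 : (2 ^ p.toReal + 1) / 3 ^ (n + 1) * N = (2 ^ p.toReal + 1) / 3 ^ n * N / 3 := by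
      rw [pow_succ]
      field_simp
    rw [h6]
    linarith

variable {Ω : Type*} [MeasurableSpace Ω] {μ : Measure Ω} {p : ℝ≥0∞} [Fact (1 ≤ p)]

/-- A sectorial bound on the numerical range of `B` bounds `exp (w B)` in a sector. -/
lemma norm_exp_smul_le_of_sector (hp : p ≠ ∞) {B : Lp ℂ p μ →L[ℂ] Lp ℂ p μ} {η K δ : ℝ}
    (hη : 0 < η) (hδ : 0 < δ) (hδK : δ * K ≤ 1)
    (hB : ∀ F, (dualityPairing (B F) F).re ≤ 0 ∧ |(dualityPairing (B F) F).im|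
          ≤ η * ‖F‖ ^ p.toReal + K * -(dualityPairing (B F) F).re)
    {w : ℂ} (hw : 0 < w.re) (hw2 : |w.im| ≤ δ * w.re) :
    ‖NormedSpace.exp (w • B)‖ ≤ Real.exp (p.toReal * (δ * η) * w.re) := by
  set z : ℂ := ⟨1, w.im / w.re⟩
  have hz : w = (w.re : ℂ) * z := by
    apply Complex.ext <;> simp [z]
    field_simp
  have hσ : |w.im / w.re| ≤ δ := by
    rwa [abs_div, abs_of_pos hw, div_le_iff₀ hw]
  have h := norm_exp_smul_le_of_re_dualityPairing_le hp (T := z • B) (ω := δ * η) (by positivity)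
    (fun F ↦ ?_) hw
  · have e : w.re • z • B = w • B := by
      conv_rhs => rw [hz]
      rw [mul_smul, Complex.coe_smul]
      rfl
    rwa [e] at h
  · obtain ⟨hre, him⟩ := hB F
    rw [smul_apply, dualityPairing_smul, Complex.mul_re]
    set a := dualityPairing (B F) F
    have h1 : -(w.im / w.re * a.im) ≤ δ * |a.im| := by
      refine (neg_le_abs _).trans ?_
      rw [abs_mul]
      gcongr
    have h2 := mul_le_mul_of_nonneg_left him hδ.le
    have h3 := mul_le_mul_of_nonneg_right hδK (neg_nonneg.2 hre)
    change 1 * a.re - w.im / w.re * a.im ≤ _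
    linarith

/-- Cauchy's estimate turns sectorial growth bounds into decay of `exp (t B) B`. -/
lemma norm_exp_smul_mul_le_of_sector {𝔸 : Type*} [NormedRing 𝔸] [NormedAlgebra ℂ 𝔸]
    [CompleteSpace 𝔸] {B : 𝔸} {c δ : ℝ} (hc : 0 < c) (hδ : 0 < δ) (hδ1 : δ ≤ 1)
    (hB : ∀ w : ℂ, 0 < w.re → |w.im| ≤ δ * w.re → ‖NormedSpace.exp (w • B)‖ ≤ Real.exp (c * w.re))
    {t : ℝ} (ht : 0 < t) :
    ‖NormedSpace.exp ((t : ℂ) • B) * B‖ ≤ Real.exp (c * (3 * t / 2)) / (δ * t / 2) := by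
  have hd : ∀ w : ℂ, HasDerivAt (fun w : ℂ ↦ NormedSpace.exp (w • B))
      (NormedSpace.exp (w • B) * B) w := fun w ↦ hasDerivAt_exp_smul_const B w
  rw [← (hd t).deriv]
  refine Complex.norm_deriv_le_of_forall_mem_sphere_norm_le (by positivity)
    (Differentiable.diffContOnCl fun w ↦ (hd w).differentiableAt) fun w hw ↦ ?_
  have hw' : ‖w - t‖ = δ * t / 2 := mem_sphere_iff_norm.1 hw
  have h1 := (Complex.abs_re_le_norm (w - t)).trans hw'.le
  have h2 := (Complex.abs_im_le_norm (w - t)).trans hw'.le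
  rw [Complex.sub_re, Complex.ofReal_re, abs_le] at h1
  rw [Complex.sub_im, Complex.ofReal_im, sub_zero] at h2
  have h3 : δ * t ≤ t := by nlinarith
  refine (hB w (by linarith) (by nlinarith)).trans ?_
  gcongr
  linarith

end NumericalRange

section UniformBound

lemma exp_add_smul {E : Type*} [NormedAddCommGroup E] [NormedSpace ℝ E] [CompleteSpace E]
    (A : E →L[ℝ] E) (s t : ℝ) : NormedSpace.exp ((s + t) • A)
      = NormedSpace.exp (s • A) * NormedSpace.exp (t • A) := by
  let : NormedAlgebra ℚ (E →L[ℝ] E) := NormedAlgebra.restrictScalars ℚ ℝ _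
  rw [add_smul, NormedSpace.exp_add_of_commute
    (((Commute.refl A).smul_left s).smul_right t)]

/-- A normalised generator of a contractive semigroup on `L^p`, `p ≠ 2`, satisfies a uniform lower
bound on the norm of some inverse of the semigroup. -/
lemma exists_lt_norm_exp_neg_smul {p : ℝ≥0∞} [Fact (1 ≤ p)] (hp : p ≠ ∞) (hp2 : p ≠ 2) {M : ℝ}
    (hM : 0 < M) :
    ∃ T : ℝ, 0 < T ∧ ∀ (Ω : Type*) (_ : MeasurableSpace Ω) (μ : Measure Ω)
      (A : Lp ℝ p μ →L[ℝ] Lp ℝ p μ), ‖A‖ = 1 →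
      (∀ t : ℝ, 0 ≤ t → ‖NormedSpace.exp (t • A)‖ ≤ 1) →
      M < ‖NormedSpace.exp ((-T) • A)‖ := by
  have hq : 1 ≤ p.toReal := one_le_toReal_of_fact hp
  have hq2 : p.toReal ≠ 2 := fun h ↦ hp2 <|
    (ENNReal.toReal_eq_toReal_iff' hp (by simp)).1 (by simpa using h)
  set e := Real.exp (p.toReal * (3 / 2)) with he
  have he0 : 0 < e := Real.exp_pos _
  set η : ℝ := 1 / (4 * M * e) with hη
  have hη0 : 0 < η := by positivity
  obtain ⟨n, hn⟩ : ∃ n : ℕ, (2 ^ p.toReal + 1) / 3 ^ n ≤ η := by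
    obtain ⟨n, hn⟩ := pow_unbounded_of_one_lt ((2 ^ p.toReal + 1) / η)
      (by norm_num : (1 : ℝ) < 3)
    refine ⟨n, ?_⟩
    rw [div_lt_iff₀ hη0] at hn
    rw [div_le_iff₀ (by positivity)]
    linarith
  obtain ⟨K, hK0, hK⟩ := exists_abs_im_dualityPairing_le hp hq2 n
  set δ : ℝ := 1 / (K + 1) with hδ
  have hδ0 : 0 < δ := by positivity
  have hδ1 : δ ≤ 1 := by
    rw [hδ, div_le_one (by positivity)]
    linarith
  have hδK : δ * K ≤ 1 := by
    rw [hδ, one_div_mul_eq_div, div_le_one (by positivity)]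
    linarith
  refine ⟨1 / (δ * η), by positivity, fun Ω _ μ A hA1 hA ↦ ?_⟩
  set T := 1 / (δ * η) with hT
  have hT0 : 0 < T := by positivity
  by_contra! hcon
  have hsector := fun F ↦ hK Ω _ μ (complexify A)
    (by simpa [hA1] using norm_complexify_le A) (integral_complexify_re_nonpos hp hA) F
  have hsector_eta : ∀ F, (dualityPairing (complexify A F) F).re ≤ 0 ∧
      |(dualityPairing (complexify A F) F).im|
        ≤ η * ‖F‖ ^ p.toReal + K * -(dualityPairing (complexify A F) F).re := fun F ↦
    ⟨(hsector F).1, (hsector F).2.trans (by gcongr)⟩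
  have hdecay := norm_exp_smul_mul_le_of_sector (B := complexify A) (c := p.toReal * (δ * η))
    (by positivity) hδ0 hδ1
    (fun w hw hw2 ↦ norm_exp_smul_le_of_sector hp hη0 hδ0 hδK hsector_eta hw hw2) hT0
  have e1 : p.toReal * (δ * η) * (3 * T / 2) = p.toReal * (3 / 2) := by
    rw [hT]
    field_simp
  have e2 : e / (δ * T / 2) = 1 / (2 * M) := by
    rw [hT, hη]
    field_simp
    norm_num
  rw [e1, ← he, e2] at hdecay
  have hreal : ‖NormedSpace.exp (T • A) * A‖ ≤ 1 / (2 * M) := by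
    refine ContinuousLinearMap.opNorm_le_bound _ (by positivity) fun f ↦ ?_
    rw [mul_apply_eq_comp, ← norm_lpOfReal, ← exp_complexify_lpOfReal, ← complexify_lpOfReal,
      ← norm_lpOfReal f]
    exact ContinuousLinearMap.le_of_opNorm_le _ hdecay _
  have hA_eq : A = NormedSpace.exp ((-T) • A) * (NormedSpace.exp (T • A) * A) := by
    rw [← mul_assoc, ← exp_add_smul, neg_add_cancel, zero_smul, NormedSpace.exp_zero, one_mul]
  have : (1 : ℝ) ≤ M * (1 / (2 * M)) := by
    calc (1 : ℝ) = ‖NormedSpace.exp ((-T) • A) * (NormedSpace.exp (T • A) * A)‖ := by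
          rw [← hA_eq, hA1]
      _ ≤ _ := (norm_mul_le _ _).trans (mul_le_mul hcon hreal (norm_nonneg _) hM.le)
  have e3 : M * (1 / (2 * M)) = 1 / 2 := by field_simp
  linarith

end UniformBound

/-- **Uniform bound for generators of contractive semigroups on `L^p`, `p ≠ 2`.**
Fix `p ∈ [1,∞)` with `p ≠ 2` and `M ≥ 1`. Then there is a constant `C = C(p,M) ∈ [0,∞)`
such that every bounded linear operator `Q` on a real `L^p`-space (over an arbitrary
measure space) whose semigroup `(e^{tQ})_{t ≥ 0}` is contractive and which satisfies
`‖e^{-Q}‖ ≤ M` has norm `‖Q‖ ≤ C`. -/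
theorem contractive_semigroup_generator_norm_bound_Lp
    (p : ℝ≥0∞) [Fact (1 ≤ p)] (hp_ne_two : p ≠ 2) (hp_ne_top : p ≠ ∞)
    (M : ℝ) (hM : 1 ≤ M) :
    ∃ C : ℝ, 0 ≤ C ∧
      ∀ (Ω : Type*) (_ : MeasurableSpace Ω) (μ : Measure Ω)
        (Q : Lp ℝ p μ →L[ℝ] Lp ℝ p μ),
        (∀ t : ℝ, 0 ≤ t → ‖NormedSpace.exp (t • Q)‖ ≤ 1) →
        ‖NormedSpace.exp (-Q)‖ ≤ M →
        ‖Q‖ ≤ C := by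
  obtain ⟨T, hT0, hT⟩ := exists_lt_norm_exp_neg_smul hp_ne_top hp_ne_two
    (zero_lt_one.trans_le hM)
  refine ⟨T, hT0.le, fun Ω _ μ Q hQ hQM ↦ ?_⟩
  by_contra! hTQ
  have hQ0 : 0 < ‖Q‖ := hT0.trans hTQ
  have hlt := hT Ω _ μ (‖Q‖⁻¹ • Q)
    (by rw [norm_smul, norm_inv, norm_norm, inv_mul_cancel₀ hQ0.ne'])
    (fun t ht ↦ by
      rw [smul_smul]
      exact hQ _ (by positivity))
  have hs : T * ‖Q‖⁻¹ ≤ 1 := by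
    rw [← div_eq_mul_inv, div_le_one hQ0]
    exact hTQ.le
  have hsplit : (-T) • ‖Q‖⁻¹ • Q = (-1 + (1 - T * ‖Q‖⁻¹)) • Q := by
    rw [smul_smul]
    congr 1
    ring
  rw [hsplit, exp_add_smul, neg_one_smul] at hlt
  have := (norm_mul_le _ _).trans (mul_le_mul hQM (hQ (1 - T * ‖Q‖⁻¹) (by linarith))
    (norm_nonneg _) (by linarith))
  linarith
end
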